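/- For any weak composition a, the Lascoux polynomial expands positively into quasiLascoux polynomials: D̄_a = Σ_{b ∈ Qlswap(a)} Q̄_b, where Qlswap(a) consists of the dominance-minimal elements of lswap(a) within each class of fixed positive part. -/

import Mathlib

def Dominates (b a : List ℕ) : Prop :=
  b.length = a.length ∧ ∀ i : ℕ, (a.take i).sum ≤ (b.take i).sum

def posPart (a : List ℕ) : List ℕ := a.filter (fun v => v != 0)
def skyline (a : List ℕ) : Finset (ℕ × ℕ) :=
  (Finset.range a.length).biUnion fun i =>
    (Finset.range (a.getD i 0)).image fun j => (i + 1, j + 1)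
abbrev SVF : Type := ℕ → ℕ → Finset ℕ

def shapeLen (b : List ℕ) (i : ℕ) : ℕ := b.getD (i - 1) 0

def SBox (b : List ℕ) (i j : ℕ) : Prop :=
  1 ≤ i ∧ i ≤ b.length ∧ 1 ≤ j ∧ j ≤ shapeLen b i

def anc (F : SVF) (i j : ℕ) : ℕ := (F i j).sup id

noncomputable def infv (F : SVF) (i j : ℕ) : ℕ := sInf (F i j : Set ℕ)

def InvTriple (be al ga : ℕ) : Prop := (ga < al ∧ al ≤ be) ∨ (al ≤ be ∧ be < ga)

def RowOK (b : List ℕ) (F : SVF) (i j v : ℕ) : Prop :=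
  (j = 1 ∨ v ≤ infv F i (j - 1)) ∧ (¬ SBox b i (j + 1) ∨ anc F i (j + 1) ≤ v)

def SVSSF (b : List ℕ) (F : SVF) : Prop :=
  (∀ i j, (F i j).Nonempty ↔ SBox b i j) ∧
  (∀ i j v, v ∈ F i j → 0 < v) ∧
  (∀ j i i', i ≠ i' → ∀ v, v ∈ F i j → v ∉ F i' j) ∧
  (∀ i j, SBox b i j → SBox b i (j + 1) → anc F i (j + 1) ≤ infv F i j) ∧
  (∀ i i' j, i < i' → SBox b i j → SBox b i (j + 1) → SBox b i' (j + 1) →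
      shapeLen b i' ≤ shapeLen b i → InvTriple (anc F i j) (anc F i (j + 1)) (anc F i' (j + 1))) ∧
  (∀ i i' j, i < i' → SBox b i' j → SBox b i' (j + 1) → SBox b i j →
      shapeLen b i < shapeLen b i' → InvTriple (anc F i' j) (anc F i' (j + 1)) (anc F i j)) ∧
  (∀ i j v, SBox b i j → v ∈ F i j → v ≠ anc F i j →
      ∀ i', SBox b i' j → anc F i' j < anc F i j → v < anc F i' j → ¬ RowOK b F i' j v)

def LASSF (b : List ℕ) (F : SVF) : Prop :=
  SVSSF b F ∧ ∀ i, SBox b i 1 → anc F i 1 = i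

def wtF (b : List ℕ) (F : SVF) (v : ℕ) : ℕ :=
  ((skyline b).filter fun p => v ∈ F p.1 p.2).card

def sizeF (b : List ℕ) (F : SVF) : ℕ := ∑ p ∈ skyline b, (F p.1 p.2).card
noncomputable def vmono (w : ℕ → ℕ) : MvPolynomial ℕ (Polynomial ℤ) :=
  ∏ᶠ v, MvPolynomial.X v ^ w v

noncomputable def atomPoly (b : List ℕ) : MvPolynomial ℕ (Polynomial ℤ) :=
  ∑ᶠ F ∈ {F : SVF | LASSF b F},
    MvPolynomial.C (Polynomial.X ^ (sizeF b F - b.sum)) * vmono (wtF b F)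

noncomputable def quasiLascoux (a : List ℕ) : MvPolynomial ℕ (Polynomial ℤ) :=
  ∑ᶠ b ∈ {b : List ℕ | Dominates b a ∧ posPart b = posPart a}, atomPoly b
def BBox (a : List ℕ) (i j : ℕ) : Prop :=
  (1 ≤ i ∧ i ≤ a.length ∧ j = 0) ∨ SBox a.reverse i j

def RowOKB (a : List ℕ) (F : SVF) (i j v : ℕ) : Prop :=
  v ≤ infv F i (j - 1) ∧ (¬ BBox a i (j + 1) ∨ anc F i (j + 1) ≤ v)

def LSSF (a : List ℕ) (F : SVF) : Prop :=
  (∀ i j, (F i j).Nonempty ↔ BBox a i j) ∧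
  (∀ i, 1 ≤ i → i ≤ a.length → F i 0 = {a.length - i + 1}) ∧
  (∀ i j v, v ∈ F i j → 0 < v) ∧
  (∀ j i i', i ≠ i' → ∀ v, v ∈ F i j → v ∉ F i' j) ∧
  (∀ i j, BBox a i j → BBox a i (j + 1) → anc F i (j + 1) ≤ infv F i j) ∧
  (∀ i i' j, i < i' → BBox a i j → BBox a i (j + 1) → BBox a i' (j + 1) →
      shapeLen a.reverse i' ≤ shapeLen a.reverse i →
      InvTriple (anc F i j) (anc F i (j + 1)) (anc F i' (j + 1))) ∧
  (∀ i i' j, i < i' → BBox a i' j → BBox a i' (j + 1) → BBox a i j →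
      shapeLen a.reverse i < shapeLen a.reverse i' →
      InvTriple (anc F i' j) (anc F i' (j + 1)) (anc F i j)) ∧
  (∀ i j v, BBox a i j → 1 ≤ j → v ∈ F i j → v ≠ anc F i j →
      ∀ i', BBox a i' j → anc F i' j < anc F i j → v < anc F i' j → ¬ RowOKB a F i' j v)

noncomputable def lascouxPoly (a : List ℕ) : MvPolynomial ℕ (Polynomial ℤ) :=
  ∑ᶠ F ∈ {F : SVF | LSSF a F},
    MvPolynomial.C (Polynomial.X ^ (sizeF a.reverse F - a.sum)) * vmono (wtF a.reverse F)
def LSwapStep (a b : List ℕ) : Prop :=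
  ∃ i j, i < j ∧ j < a.length ∧ a.getD i 0 ≤ a.getD j 0 ∧
    b = (a.set i (a.getD j 0)).set j (a.getD i 0)

def lswapSet (a : List ℕ) : Set (List ℕ) := {b | Relation.ReflTransGen LSwapStep a b}

def QlswapSet (a : List ℕ) : Set (List ℕ) :=
  {b ∈ lswapSet a | ∀ c ∈ lswapSet a, posPart c = posPart b → Dominates c b}

set_option linter.unusedVariables false
def PC (v v' l w w' m : ℕ) : Prop :=
  (m ≤ l → ¬ (v' < w' ∧ w' ≤ v)) ∧ (l < m → ¬ (0 < v ∧ w' ≤ v ∧ v ≤ w))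

def Th (ab : Prop) (r r' z p p' x q q' y : ℕ) : Prop :=
  (ab → PC r r' z p p' x ∧ PC r r' z q q' y) ∧ (¬ ab → PC p p' x r r' z ∧ PC q q' y r r' z)

def CovR (ab : Prop) (r z p x q y : ℕ) : Prop :=
  (ab → ¬ (q < r ∧ r < p ∧ y ≤ z ∧ z < x)) ∧ (¬ ab → ¬ (q < r ∧ r < p ∧ y < z ∧ z ≤ x))

section arith
variable {ab : Prop} {j r r' z p u x q v y : ℕ}

-- T1: (p->u:x, q->v:y);  T3 : (q->u:x, p->v:y)
theorem ar1a (h1 : 0 < r ↔ j ≤ z) (h2 : 0 < r' ↔ j + 1 ≤ z) (h3 : r' ≤ r)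
    (hp : 0 < p ↔ j ≤ x) (hq : 0 < q ↔ j ≤ y) (hu : 0 < u ↔ j + 1 ≤ x) (hv : 0 < v ↔ j + 1 ≤ y)
    (d1 : 0 < r → r ≠ p ∧ r ≠ q) (d2 : 0 < r' → r' ≠ u ∧ r' ≠ v)
    (hpq : q < p) (huv : v < u) (hxy : y < x) (huq : u ≤ q) :
    Th ab r r' z p u x q v y ↔ CovR ab r z p x q y ∧ Th ab r r' z q u x p v y := by
  unfold Th CovR PC
  by_cases ab <;> simp only [*, true_imp_iff, not_true, not_false_iff, false_imp_iff, true_and, and_true] <;> omega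

-- u>q : T1 & cov' <-> cov & T3 : (q->v:x, p->u:y)
theorem ar1b (h1 : 0 < r ↔ j ≤ z) (h2 : 0 < r' ↔ j + 1 ≤ z) (h3 : r' ≤ r)
    (hp : 0 < p ↔ j ≤ x) (hq : 0 < q ↔ j ≤ y) (hu : 0 < u ↔ j + 1 ≤ x) (hv : 0 < v ↔ j + 1 ≤ y)
    (d1 : 0 < r → r ≠ p ∧ r ≠ q) (d2 : 0 < r' → r' ≠ u ∧ r' ≠ v)
    (hpq : q < p) (huv : v < u) (hxy : y < x) (huq : q < u) (hup : u ≤ p) (hvq : v ≤ q) (hv0 : 0 < v) :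
    (CovR ab r' z u x v y ∧ Th ab r r' z p u x q v y) ↔ CovR ab r z p x q y ∧ Th ab r r' z q v x p u y := by
  unfold Th CovR PC
  by_cases ab <;> simp only [*, true_imp_iff, not_true, not_false_iff, false_imp_iff, true_and, and_true] <;> omega

-- P2: p:x, q:y, x<y ; T1a p->u, q->v ; T1b p->v, q->u
theorem ar2 (h1 : 0 < r ↔ j ≤ z) (h2 : 0 < r' ↔ j + 1 ≤ z) (h3 : r' ≤ r)
    (hp : 0 < p ↔ j ≤ x) (hq : 0 < q ↔ j ≤ y) (hu : 0 < u ↔ j + 1 ≤ x) (hv : 0 < v ↔ j + 1 ≤ y)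
    (d1 : 0 < r → r ≠ p ∧ r ≠ q) (d2 : 0 < r' → r' ≠ u ∧ r' ≠ v)
    (hpq : q < p) (huv : v < u) (hxy : x < y) (huq : u ≤ q) :
    Th ab r r' z p u x q v y ↔ CovR ab r' z u y v x ∧ Th ab r r' z p v x q u y := by
  unfold Th CovR PC
  by_cases ab <;> simp only [*, true_imp_iff, not_true, not_false_iff, false_imp_iff, true_and, and_true] <;> omega

theorem ar3 (h1 : 0 < r ↔ j ≤ z) (h2 : 0 < r' ↔ j + 1 ≤ z) (h3 : r' ≤ r)
    (d1 : 0 < r → r ≠ p ∧ r ≠ q) (d2 : 0 < r' → r' ≠ u ∧ r' ≠ v)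
    (hpq : q < p) (huv : v < u) (huq : u ≤ q) :
    Th ab r r' z p u x q v x ↔ Th ab r r' z q u x p v x := by
  unfold Th PC
  by_cases ab <;> simp only [*, true_imp_iff, not_true, not_false_iff, false_imp_iff, true_and, and_true] <;> omega
end arith

section trans
variable {n : ℕ}

def Valid (j : ℕ) (γ σ : Fin n → ℕ) : Prop :=
  (∀ i, 0 < σ i ↔ j ≤ γ i) ∧ ∀ i k, σ i = σ k → 0 < σ i → i = k

def Tr (γ σ σ' : Fin n → ℕ) : Prop :=
  (∀ i, σ' i ≤ σ i) ∧ ∀ i k, i < k → PC (σ i) (σ' i) (γ i) (σ k) (σ' k) (γ k)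

def pset (σ : Fin n → ℕ) : Finset ℕ := (Finset.univ.image σ).erase 0

open Classical in
noncomputable def NN (A : ℕ → Finset ℕ) : ℕ → ℕ → (Fin n → ℕ) → (Fin n → ℕ) → ℤ
  | 0, j, γ, σ => if Valid j γ σ ∧ ∀ i, σ i = 0 then 1 else 0
  | m + 1, j, γ, σ => if Valid j γ σ then
      ∑ σ' ∈ Fintype.piFinset (fun _ : Fin n => insert 0 (A (j + 1))),
        if Tr γ σ σ' ∧ pset σ' = A (j + 1) then NN A m (j + 1) γ σ' else 0 else 0

theorem NN_invalid {A : ℕ → Finset ℕ} {m j : ℕ} {γ σ : Fin n → ℕ} (h : ¬ Valid j γ σ) :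
    NN A m j γ σ = 0 := by
  cases m <;> simp [NN, h]

def OutT (i i1 : Fin n) (γ σ σ' : Fin n → ℕ) : Prop :=
  (∀ k, k ≠ i → k ≠ i1 → σ' k ≤ σ k) ∧ ∀ k l, k ≠ i → k ≠ i1 → l ≠ i → l ≠ i1 → k < l →
    PC (σ k) (σ' k) (γ k) (σ l) (σ' l) (γ l)

theorem Tr_iff {i i1 : Fin n} (hi : i1.val = i.val + 1) (γ σ σ' : Fin n → ℕ) :
    Tr γ σ σ' ↔ OutT i i1 γ σ σ' ∧ (σ' i ≤ σ i ∧ σ' i1 ≤ σ i1 ∧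
      PC (σ i) (σ' i) (γ i) (σ i1) (σ' i1) (γ i1)) ∧
      ∀ k, k ≠ i → k ≠ i1 → Th (k < i) (σ k) (σ' k) (γ k) (σ i) (σ' i) (γ i) (σ i1) (σ' i1) (γ i1) := by
  constructor
  · rintro ⟨h1, h2⟩
    refine ⟨⟨fun k _ _ => h1 k, fun k l _ _ _ _ h => h2 k l h⟩,
      ⟨h1 i, h1 i1, h2 _ _ (by rw [Fin.lt_def]; omega)⟩, fun k hk hk1 => ⟨fun h => ?_, fun h => ?_⟩⟩
    · exact ⟨h2 _ _ h, h2 _ _ (by rw [Fin.lt_def] at *; omega)⟩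
    · have a1 : k.val ≠ i.val := fun h => hk (Fin.ext h)
      have a2 : k.val ≠ i1.val := fun h => hk1 (Fin.ext h)
      rw [Fin.lt_def] at h
      exact ⟨h2 _ _ (by rw [Fin.lt_def]; omega), h2 _ _ (by rw [Fin.lt_def]; omega)⟩
  · rintro ⟨⟨h1, h2⟩, ⟨h3, h4, h5⟩, h6⟩
    constructor
    · intro k
      by_cases hk : k = i
      · subst hk; exact h3
      by_cases hk1 : k = i1
      · subst hk1; exact h4
      exact h1 k hk hk1
    · intro k l hkl
      by_cases hk : k = i
      · subst hk
        by_cases hl1 : l = i1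
        · subst hl1; exact h5
        · have hl : l ≠ k := hkl.ne'
          exact ((h6 l hl hl1).2 (not_lt.2 hkl.le)).1
      by_cases hk1 : k = i1
      · subst hk1
        have hl : l ≠ i := by rintro rfl; rw [Fin.lt_def] at hkl; omega
        exact ((h6 l hl hkl.ne').2 (by rw [Fin.lt_def] at *; omega)).2
      by_cases hl : l = i
      · subst hl
        exact ((h6 k hk hk1).1 hkl).1
      by_cases hl1 : l = i1
      · subst hl1
        have a1 : k.val ≠ i.val := fun h => hk (Fin.ext h)
        exact ((h6 k hk hk1).1 (by rw [Fin.lt_def] at *; omega)).2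
      exact h2 k l hk hk1 hl hl1 hkl

def Cov (i i1 : Fin n) (γ σ : Fin n → ℕ) : Prop :=
  ∀ k, k ≠ i → k ≠ i1 → CovR (k < i) (σ k) (γ k) (σ i) (γ i) (σ i1) (γ i1)

theorem Valid_swap {j : ℕ} {γ σ : Fin n → ℕ} (s : Equiv.Perm (Fin n)) :
    Valid j (γ ∘ s) (σ ∘ s) ↔ Valid j γ σ := by
  constructor
  · rintro ⟨h1, h2⟩
    refine ⟨fun i => by simpa using h1 (s.symm i), fun i k h h' => ?_⟩
    have := h2 (s.symm i) (s.symm k) (by simpa using h) (by simpa using h')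
    simpa using this
  · rintro ⟨h1, h2⟩
    refine ⟨fun i => by simpa using h1 (s i), fun i k h h' => ?_⟩
    exact s.injective (h2 _ _ h h')

theorem pset_swap {σ : Fin n → ℕ} (s : Equiv.Perm (Fin n)) : pset (σ ∘ s) = pset σ := by
  unfold pset; congr 1
  ext x; simp only [Finset.mem_image, Finset.mem_univ, true_and, Function.comp]
  exact ⟨fun ⟨a, h⟩ => ⟨_, h⟩, fun ⟨a, h⟩ => ⟨s.symm a, by simpa using h⟩⟩

theorem sum_pair (S : Finset ℕ) (s : Equiv.Perm (Fin n)) (hs : ∀ i, s (s i) = i) (g : (Fin n → ℕ) → ℤ)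
    (h : ∀ σ, g σ + g (σ ∘ s) = 0) : ∑ σ ∈ Fintype.piFinset (fun _ : Fin n => S), g σ = 0 := by
  have h1 : ∑ σ ∈ Fintype.piFinset (fun _ : Fin n => S), g σ
      = ∑ σ ∈ Fintype.piFinset (fun _ : Fin n => S), g (σ ∘ s) := by
    symm
    apply Finset.sum_nbij' (fun σ => σ ∘ s) (fun σ => σ ∘ s)
    · intro σ hσ; simp only [Fintype.mem_piFinset] at *; intro i; exact hσ _
    · intro σ hσ; simp only [Fintype.mem_piFinset] at *; intro i; exact hσ _
    · intro σ _; ext i; simp [hs]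
    · intro σ _; ext i; simp [hs]
    · intro σ _; rfl
  have h2 : ∑ σ ∈ Fintype.piFinset (fun _ : Fin n => S), g σ
      + ∑ σ ∈ Fintype.piFinset (fun _ : Fin n => S), g (σ ∘ s) = 0 := by
    rw [← Finset.sum_add_distrib]; exact Finset.sum_eq_zero (fun σ _ => h σ)
  omega
end trans

set_option linter.unusedVariables false
section trans2
variable {n : ℕ}

def TV (i i1 : Fin n) (γ σ σ' : Fin n → ℕ) (p u x q v y : ℕ) : Prop :=
  OutT i i1 γ σ σ' ∧ (u ≤ p ∧ v ≤ q ∧ PC p u x q v y) ∧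
      ∀ k, k ≠ i → k ≠ i1 → Th (k < i) (σ k) (σ' k) (γ k) p u x q v y

theorem Tr_TV {i i1 : Fin n} (hi : i1.val = i.val + 1) (γ σ σ' γ1 σ1 σ1' : Fin n → ℕ)
    (h1 : ∀ k, k ≠ i → k ≠ i1 → γ1 k = γ k) (h2 : ∀ k, k ≠ i → k ≠ i1 → σ1 k = σ k)
    (h3 : ∀ k, k ≠ i → k ≠ i1 → σ1' k = σ' k) :
    Tr γ1 σ1 σ1' ↔ TV i i1 γ σ σ' (σ1 i) (σ1' i) (γ1 i) (σ1 i1) (σ1' i1) (γ1 i1) := by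
  rw [Tr_iff hi, TV]
  refine and_congr ?_ (and_congr Iff.rfl ?_)
  · unfold OutT
    refine and_congr ?_ ?_
    · refine forall_congr' fun k => forall_congr' fun hk => forall_congr' fun hk1 => ?_
      rw [h2 k hk hk1, h3 k hk hk1]
    · refine forall_congr' fun k => forall_congr' fun l => forall_congr' fun hk =>
        forall_congr' fun hk1 => forall_congr' fun hl => forall_congr' fun hl1 => ?_
      rw [h1 k hk hk1, h2 k hk hk1, h3 k hk hk1, h1 l hl hl1, h2 l hl hl1, h3 l hl hl1]
  · refine forall_congr' fun k => forall_congr' fun hk => forall_congr' fun hk1 => ?_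
    rw [h1 k hk hk1, h2 k hk hk1, h3 k hk hk1]

theorem Th_comm {ab : Prop} {r r' z p u x q v y : ℕ} :
    Th ab r r' z q v y p u x ↔ Th ab r r' z p u x q v y := by
  unfold Th
  exact and_congr (forall_congr' fun _ => and_comm) (forall_congr' fun _ => and_comm)

structure SRel (J : ℕ) (f : (Fin n → ℕ) → (Fin n → ℕ) → ℤ) : Prop where
  inv : ∀ γ σ, ¬ Valid J γ σ → f γ σ = 0
  p0 : ∀ i i1 : Fin n, i1.val = i.val + 1 → ∀ γ σ, σ i = 0 → σ i1 = 0 →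
    f γ σ = f (γ ∘ Equiv.swap i i1) σ
  p1 : ∀ i i1 : Fin n, i1.val = i.val + 1 → ∀ γ σ, σ i1 < σ i → γ i1 < γ i →
    (Cov i i1 γ σ → f γ σ = f (γ ∘ Equiv.swap i i1) (σ ∘ Equiv.swap i i1) + f γ (σ ∘ Equiv.swap i i1)) ∧
    (¬ Cov i i1 γ σ → f γ σ = f (γ ∘ Equiv.swap i i1) (σ ∘ Equiv.swap i i1))
  p2 : ∀ i i1 : Fin n, i1.val = i.val + 1 → ∀ γ σ, σ i1 < σ i → γ i ≤ γ i1 →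
    f γ σ = f (γ ∘ Equiv.swap i i1) (σ ∘ Equiv.swap i i1)

open Classical in
noncomputable def tm (A : Finset ℕ) (f : (Fin n → ℕ) → (Fin n → ℕ) → ℤ) (γ σ σ' : Fin n → ℕ) : ℤ :=
  if Tr γ σ σ' ∧ pset σ' = A then f γ σ' else 0

open Classical in
noncomputable def stepf (j : ℕ) (A : Finset ℕ) (f : (Fin n → ℕ) → (Fin n → ℕ) → ℤ) (γ σ : Fin n → ℕ) : ℤ :=
  if Valid j γ σ then
      ∑ σ' ∈ Fintype.piFinset (fun _ : Fin n => insert 0 A), tm A f γ σ σ' else 0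

-- validity facts, target
theorem vfacts {J : ℕ} {γ σ : Fin n → ℕ} (h : Valid J γ σ) (i i1 k : Fin n) (hk : k ≠ i) (hk1 : k ≠ i1) :
    (0 < σ k ↔ J ≤ γ k) ∧ (0 < σ k → σ k ≠ σ i ∧ σ k ≠ σ i1) :=
  ⟨h.1 k, fun h0 => ⟨fun e => hk (h.2 _ _ e h0), fun e => hk1 (h.2 _ _ e h0)⟩⟩

set_option maxHeartbeats 1000000 in
theorem term1 {j : ℕ} {f : (Fin n → ℕ) → (Fin n → ℕ) → ℤ} (hf : SRel (j + 1) f) {i i1 : Fin n}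
    (hi : i1.val = i.val + 1) {γ σ : Fin n → ℕ} (hV : Valid j γ σ) (A : Finset ℕ) (hpq : σ i1 < σ i) (hxy : γ i1 < γ i) (hq0 : 0 < σ i1) (σ' : Fin n → ℕ)
    (huv : σ' i1 ≤ σ' i) (cov : ℤ) (hc : cov = open Classical in if Cov i i1 γ σ then 1 else 0) :
    (tm A f γ σ σ' - tm A f (γ ∘ Equiv.swap i i1) (σ ∘ Equiv.swap i i1) σ' -
      cov * tm A f γ (σ ∘ Equiv.swap i i1) σ') +
    (tm A f γ σ (σ' ∘ Equiv.swap i i1) -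
      tm A f (γ ∘ Equiv.swap i i1) (σ ∘ Equiv.swap i i1) (σ' ∘ Equiv.swap i i1) -
      cov * tm A f γ (σ ∘ Equiv.swap i i1) (σ' ∘ Equiv.swap i i1)) = 0 := by
  classical
  set s := Equiv.swap i i1 with hs
  have so : ∀ (τ : Fin n → ℕ) k, k ≠ i → k ≠ i1 → (τ ∘ s) k = τ k := fun τ k h1 h2 => by
    simp [hs, Equiv.swap_apply_of_ne_of_ne h1 h2]
  have si : ∀ (τ : Fin n → ℕ), (τ ∘ s) i = τ i1 := fun τ => by simp [hs]
  have si1 : ∀ (τ : Fin n → ℕ), (τ ∘ s) i1 = τ i := fun τ => by simp [hs]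
  have sr : ∀ (τ : Fin n → ℕ) k, k ≠ i → k ≠ i1 → τ k = τ k := fun _ _ _ _ => rfl
  have ss : ∀ (τ : Fin n → ℕ), (τ ∘ s) ∘ s = τ := fun τ => by ext k; simp [hs]
  have T1 := Tr_TV hi γ σ σ' γ σ σ' (sr _) (sr _) (sr _)
  have T2 := Tr_TV hi γ σ σ' (γ ∘ s) (σ ∘ s) σ' (so _) (so _) (sr _)
  have T3 := Tr_TV hi γ σ σ' γ (σ ∘ s) σ' (sr _) (so _) (sr _)
  have T1' := Tr_TV hi γ σ σ' γ σ (σ' ∘ s) (sr _) (sr _) (so _)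
  have T2' := Tr_TV hi γ σ σ' (γ ∘ s) (σ ∘ s) (σ' ∘ s) (so _) (so _) (so _)
  have T3' := Tr_TV hi γ σ σ' γ (σ ∘ s) (σ' ∘ s) (sr _) (so _) (so _)
  simp only [si, si1] at T1 T2 T3 T1' T2' T3'
  simp only [tm, pset_swap, T1, T2, T3, T1', T2', T3']
  by_cases hA : pset σ' = A
  swap
  · simp [hA]
  simp only [hA, and_true]
  have hp := hV.1 i
  have hq := hV.1 i1
  have e2 : ¬ TV i i1 γ σ σ' (σ i1) (σ' i) (γ i1) (σ i) (σ' i1) (γ i) := by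
    rintro ⟨_, ⟨h1, h2, h3⟩, _⟩; unfold PC at h3; omega
  rcases huv.lt_or_eq with huv | huv
  swap
  · -- equal values: everything invalid
    have a1 : σ' ∘ s = σ' := by
      ext k
      by_cases hk : k = i
      · subst hk; rw [si, huv]
      by_cases hk1 : k = i1
      · subst hk1; rw [si1, huv]
      exact so _ _ hk hk1
    have nv : ¬ Valid (j + 1) γ σ' := by
      intro h
      have b0 := h.1 i
      have b1 := h.2 i1 i huv
      have b2 : i1 ≠ i := by intro h; rw [h] at hi; omega
      have b3 : ¬ 0 < σ' i1 := fun h => b2 (b1 h)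
      omega
    have nv' : ¬ Valid (j + 1) (γ ∘ s) σ' := by
      have := (not_congr (Valid_swap (j := j + 1) (γ := γ) (σ := σ') s)).2 nv
      rwa [a1] at this
    rw [a1, hf.inv _ _ nv, hf.inv _ _ nv']
    simp
  have e1' : ¬ TV i i1 γ σ σ' (σ i) (σ' i1) (γ i) (σ i1) (σ' i) (γ i1) := by
    rintro ⟨_, ⟨h1, h2, h3⟩, _⟩; unfold PC at h3; omega
  simp only [e2, e1', if_false]
  have hih := hf.p1 i i1 hi γ σ' huv hxy
  rw [← hs] at hih
  by_cases huq : σ' i ≤ σ i1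
  · have e2' : ¬ TV i i1 γ σ σ' (σ i1) (σ' i1) (γ i1) (σ i) (σ' i) (γ i) := by
      rintro ⟨_, ⟨h1, h2, h3⟩, _⟩; unfold PC at h3; omega
    have e3' : ¬ TV i i1 γ σ σ' (σ i1) (σ' i1) (γ i) (σ i) (σ' i) (γ i1) := by
      rintro ⟨_, ⟨h1, h2, h3⟩, _⟩; unfold PC at h3; omega
    simp only [e2', e3', if_false]
    by_cases hv : Valid (j + 1) γ σ'
    swap
    · rw [hf.inv _ _ hv]; simp
    have key : TV i i1 γ σ σ' (σ i) (σ' i) (γ i) (σ i1) (σ' i1) (γ i1) ↔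
        Cov i i1 γ σ ∧ TV i i1 γ σ σ' (σ i1) (σ' i) (γ i) (σ i) (σ' i1) (γ i1) := by
      have pk : ∀ O : OutT i i1 γ σ σ', ∀ k (hk : k ≠ i) (hk1 : k ≠ i1), _ := fun O k hk hk1 =>
        ar1a (ab := k < i) (vfacts hV i i1 k hk hk1).1 (vfacts hv i i1 k hk hk1).1 (O.1 k hk hk1) hp hq
          (hv.1 i) (hv.1 i1) (vfacts hV i i1 k hk hk1).2 (vfacts hv i i1 k hk hk1).2 hpq huv hxy huq
      constructor
      · rintro ⟨O, h2, h3⟩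
        refine ⟨fun k hk hk1 => ((pk O k hk hk1).1 (h3 k hk hk1)).1, O, ⟨by omega, by omega, ?_⟩,
          fun k hk hk1 => ((pk O k hk hk1).1 (h3 k hk hk1)).2⟩
        unfold PC; omega
      · rintro ⟨h1, O, h2, h3⟩
        refine ⟨O, ⟨by omega, by omega, ?_⟩, fun k hk hk1 => (pk O k hk hk1).2 ⟨h1 k hk hk1, h3 k hk hk1⟩⟩
        unfold PC; omega
    rw [hc]; simp only [key]
    by_cases c1 : Cov i i1 γ σ <;> simp [c1]
  · have e3 : ¬ TV i i1 γ σ σ' (σ i1) (σ' i) (γ i) (σ i) (σ' i1) (γ i1) := by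
      rintro ⟨_, ⟨h1, h2, h3⟩, _⟩; omega
    simp only [e3, if_false]
    have e12 : TV i i1 γ σ σ' (σ i1) (σ' i1) (γ i1) (σ i) (σ' i) (γ i) ↔
        TV i i1 γ σ σ' (σ i) (σ' i) (γ i) (σ i1) (σ' i1) (γ i1) := by
      unfold TV
      refine and_congr Iff.rfl (and_congr ?_ ?_)
      · unfold PC; omega
      · refine forall_congr' fun k => forall_congr' fun hk => forall_congr' fun hk1 => ?_
        exact Th_comm
    simp only [e12]
    by_cases hv : Valid (j + 1) γ (σ' ∘ s)
    swap
    · have := hf.inv _ _ hv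
      rw [this] at hih ⊢
      have : f γ σ' = f (γ ∘ s) (σ' ∘ s) := by
        by_cases c : Cov i i1 γ σ'
        · simpa using hih.1 c
        · exact hih.2 c
      rw [this]; simp
    have hvv : Valid (j + 1) γ σ' := by
      have b1 := hv.1 i
      have b2 := hv.1 i1
      rw [si] at b1
      rw [si1] at b2
      have := (Valid_swap (j := j+1) (γ := γ) (σ := σ' ∘ s) s).2 hv
      rw [ss] at this
      refine ⟨fun k => ?_, this.2⟩
      by_cases hk : k = i
      · subst hk; omega
      by_cases hk1 : k = i1
      · subst hk1; omega
      have h9 := hv.1 k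
      rwa [so _ _ hk hk1] at h9
    have hv0 : 0 < σ' i1 := by
      have b1 := hv.1 i
      have b2 := hv.1 i1
      rw [si] at b1
      rw [si1] at b2
      omega
    have key : (Cov i i1 γ σ' ∧ TV i i1 γ σ σ' (σ i) (σ' i) (γ i) (σ i1) (σ' i1) (γ i1)) ↔
        Cov i i1 γ σ ∧ TV i i1 γ σ σ' (σ i1) (σ' i1) (γ i) (σ i) (σ' i) (γ i1) := by
      have pk : ∀ O : OutT i i1 γ σ σ', ∀ (h1 : σ' i ≤ σ i) (h2 : σ' i1 ≤ σ i1), 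
          ∀ k (hk : k ≠ i) (hk1 : k ≠ i1), _ := fun O h1 h2 k hk hk1 =>
        ar1b (ab := k < i) (vfacts hV i i1 k hk hk1).1 (vfacts hvv i i1 k hk hk1).1 (O.1 k hk hk1) hp hq
          (hvv.1 i) (hvv.1 i1) (vfacts hV i i1 k hk hk1).2 (vfacts hvv i i1 k hk hk1).2 hpq huv hxy
          (not_le.1 huq) h1 h2 hv0
      constructor
      · rintro ⟨h1, O, ⟨h21, h22, _⟩, h3⟩
        refine ⟨fun k hk hk1 => ((pk O h21 h22 k hk hk1).1 ⟨h1 k hk hk1, h3 k hk hk1⟩).1, O,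
          ⟨by omega, by omega, ?_⟩,
          fun k hk hk1 => ((pk O h21 h22 k hk hk1).1 ⟨h1 k hk hk1, h3 k hk hk1⟩).2⟩
        unfold PC; omega
      · rintro ⟨h1, O, ⟨h21, h22, _⟩, h3⟩
        refine ⟨fun k hk hk1 => ((pk O h22 h21 k hk hk1).2 ⟨h1 k hk hk1, h3 k hk hk1⟩).1, O,
          ⟨by omega, by omega, ?_⟩,
          fun k hk hk1 => ((pk O h22 h21 k hk hk1).2 ⟨h1 k hk hk1, h3 k hk hk1⟩).2⟩
        unfold PC; omega
    rw [hc]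
    generalize TV i i1 γ σ σ' (σ i) (σ' i) (γ i) (σ i1) (σ' i1) (γ i1) = P at *
    generalize TV i i1 γ σ σ' (σ i1) (σ' i1) (γ i) (σ i) (σ' i) (γ i1) = Q at *
    generalize Cov i i1 γ σ = R at *
    generalize Cov i i1 γ σ' = R' at *
    by_cases hP : P <;> by_cases hQ : Q <;> by_cases hR : R <;> by_cases hR' : R' <;>
      simp [hP, hQ, hR, hR'] at key hih ⊢ <;> linarith
end trans2

set_option linter.unusedVariables false
section trans3
variable {n : ℕ}
set_option maxHeartbeats 1000000 in
theorem term2 {j : ℕ} {f : (Fin n → ℕ) → (Fin n → ℕ) → ℤ} (hf : SRel (j + 1) f) {i i1 : Fin n}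
    (hi : i1.val = i.val + 1) {γ σ : Fin n → ℕ} (hV : Valid j γ σ)
    (A : Finset ℕ) (hpq : σ i1 < σ i) (hxy : γ i ≤ γ i1) (σ' : Fin n → ℕ)
    (huv : σ' i1 ≤ σ' i) :
    (tm A f γ σ σ' - tm A f (γ ∘ Equiv.swap i i1) (σ ∘ Equiv.swap i i1) σ') +
    (tm A f γ σ (σ' ∘ Equiv.swap i i1) -
      tm A f (γ ∘ Equiv.swap i i1) (σ ∘ Equiv.swap i i1) (σ' ∘ Equiv.swap i i1)) = 0 := by
  classical
  set s := Equiv.swap i i1 with hs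
  have so : ∀ (τ : Fin n → ℕ) k, k ≠ i → k ≠ i1 → (τ ∘ s) k = τ k := fun τ k h1 h2 => by
    simp [hs, Equiv.swap_apply_of_ne_of_ne h1 h2]
  have si : ∀ (τ : Fin n → ℕ), (τ ∘ s) i = τ i1 := fun τ => by simp [hs]
  have si1 : ∀ (τ : Fin n → ℕ), (τ ∘ s) i1 = τ i := fun τ => by simp [hs]
  have sr : ∀ (τ : Fin n → ℕ) k, k ≠ i → k ≠ i1 → τ k = τ k := fun _ _ _ _ => rfl
  have ss : ∀ (τ : Fin n → ℕ), (τ ∘ s) ∘ s = τ := fun τ => by ext k; simp [hs]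
  have sfix : ∀ (τ : Fin n → ℕ), τ i1 = τ i → τ ∘ s = τ := fun τ h => by
    ext k
    by_cases hk : k = i
    · subst hk; rw [si, h]
    by_cases hk1 : k = i1
    · subst hk1; rw [si1, h]
    exact so _ _ hk hk1
  have T1 := Tr_TV hi γ σ σ' γ σ σ' (sr _) (sr _) (sr _)
  have T2 := Tr_TV hi γ σ σ' (γ ∘ s) (σ ∘ s) σ' (so _) (so _) (sr _)
  have T1' := Tr_TV hi γ σ σ' γ σ (σ' ∘ s) (sr _) (sr _) (so _)
  have T2' := Tr_TV hi γ σ σ' (γ ∘ s) (σ ∘ s) (σ' ∘ s) (so _) (so _) (so _)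
  simp only [si, si1] at T1 T2 T1' T2'
  simp only [tm, pset_swap, T1, T2, T1', T2']
  by_cases hA : pset σ' = A
  swap
  · simp [hA]
  simp only [hA, and_true]
  have hp := hV.1 i
  have hq := hV.1 i1
  have hq0 : 0 < σ i1 := by omega
  rcases huv.lt_or_eq with huv | huv
  swap
  · have a1 : σ' ∘ s = σ' := sfix _ huv
    rw [a1]
    by_cases h0 : σ' i = 0
    · have := hf.p0 i i1 hi γ σ' h0 (by omega)
      rw [← hs] at this
      have e : TV i i1 γ σ σ' (σ i) (σ' i) (γ i) (σ i1) (σ' i1) (γ i1) ↔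
        TV i i1 γ σ σ' (σ i1) (σ' i) (γ i1) (σ i) (σ' i1) (γ i) := by
        unfold TV
        refine and_congr Iff.rfl (and_congr ?_ ?_)
        · unfold PC; omega
        · refine forall_congr' fun k => forall_congr' fun hk => forall_congr' fun hk1 => ?_
          rw [huv]
          exact Th_comm
      rw [huv] at e ⊢
      simp only [e, ← this]; ring
    · have b2 : i1 ≠ i := by intro h; rw [h] at hi; omega
      have n1 : ∀ τ : Fin n → ℕ, ¬ Valid (j + 1) τ σ' := fun τ h => b2 (h.2 i1 i huv (by omega))
      rw [hf.inv _ _ (n1 _), hf.inv _ _ (n1 _)]; simp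
  have hih2 := hf.p2 i i1 hi γ σ' huv hxy
  rw [← hs] at hih2
  rcases hxy.lt_or_eq with hxy | hxy
  · have hih := hf.p1 i i1 hi (γ ∘ s) σ' huv (by rw [si, si1]; exact hxy)
    rw [← hs, ss] at hih
    by_cases huq : σ' i ≤ σ i1
    · have e2' : ¬ TV i i1 γ σ σ' (σ i1) (σ' i1) (γ i1) (σ i) (σ' i) (γ i) := by
        rintro ⟨_, ⟨h1, h2, h3⟩, _⟩; unfold PC at h3; omega
      have e1 : TV i i1 γ σ σ' (σ i1) (σ' i) (γ i1) (σ i) (σ' i1) (γ i) ↔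
          TV i i1 γ σ σ' (σ i) (σ' i1) (γ i) (σ i1) (σ' i) (γ i1) := by
        unfold TV
        refine and_congr Iff.rfl (and_congr ?_ ?_)
        · unfold PC; omega
        · refine forall_congr' fun k => forall_congr' fun hk => forall_congr' fun hk1 => ?_
          exact Th_comm
      simp only [e2', e1, if_false]
      by_cases hv : Valid (j + 1) γ σ'
      swap
      · have z1 := hf.inv _ _ hv
        rw [z1] at hih2 ⊢
        rw [← hih2] at hih
        have : f (γ ∘ s) σ' = f γ (σ' ∘ s) := by
          by_cases c : Cov i i1 (γ ∘ s) σ'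
          · simpa using hih.1 c
          · exact hih.2 c
        rw [this]; simp
      have key : TV i i1 γ σ σ' (σ i) (σ' i) (γ i) (σ i1) (σ' i1) (γ i1) ↔
          Cov i i1 (γ ∘ s) σ' ∧ TV i i1 γ σ σ' (σ i) (σ' i1) (γ i) (σ i1) (σ' i) (γ i1) := by
        have pk : ∀ O : OutT i i1 γ σ σ', ∀ k (hk : k ≠ i) (hk1 : k ≠ i1), _ := fun O k hk hk1 =>
          ar2 (ab := k < i) (vfacts hV i i1 k hk hk1).1 (vfacts hv i i1 k hk hk1).1 (O.1 k hk hk1) hp hq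
            (hv.1 i) (hv.1 i1) (vfacts hV i i1 k hk hk1).2 (vfacts hv i i1 k hk hk1).2 hpq huv hxy huq
        constructor
        · rintro ⟨O, h2, h3⟩
          refine ⟨fun k hk hk1 => ?_, O, ⟨by omega, by omega, ?_⟩,
            fun k hk hk1 => ((pk O k hk hk1).1 (h3 k hk hk1)).2⟩
          · rw [si, si1, so _ _ hk hk1]
            exact ((pk O k hk hk1).1 (h3 k hk hk1)).1
          unfold PC; omega
        · rintro ⟨h1, O, h2, h3⟩
          refine ⟨O, ⟨by omega, by omega, ?_⟩, fun k hk hk1 => (pk O k hk hk1).2 ⟨?_, h3 k hk hk1⟩⟩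
          · unfold PC; omega
          · have := h1 k hk hk1
            rwa [si, si1, so _ _ hk hk1] at this
      generalize TV i i1 γ σ σ' (σ i) (σ' i) (γ i) (σ i1) (σ' i1) (γ i1) = P at *
      generalize TV i i1 γ σ σ' (σ i) (σ' i1) (γ i) (σ i1) (σ' i) (γ i1) = Q at *
      generalize Cov i i1 (γ ∘ s) σ' = R' at *
      clear T1 T2 T1' T2' e1 e2' 
      by_cases hP : P <;> by_cases hQ : Q <;> by_cases hR' : R' <;>
        simp [hP, hQ, hR'] at key hih ⊢ <;> linarith
    · have e1' : ¬ TV i i1 γ σ σ' (σ i) (σ' i1) (γ i) (σ i1) (σ' i) (γ i1) := by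
        rintro ⟨_, ⟨h1, h2, h3⟩, _⟩; omega
      have e2 : ¬ TV i i1 γ σ σ' (σ i1) (σ' i) (γ i1) (σ i) (σ' i1) (γ i) := by
        rintro ⟨_, ⟨h1, h2, h3⟩, _⟩; omega
      have e1 : TV i i1 γ σ σ' (σ i1) (σ' i1) (γ i1) (σ i) (σ' i) (γ i) ↔
          TV i i1 γ σ σ' (σ i) (σ' i) (γ i) (σ i1) (σ' i1) (γ i1) := by
        unfold TV
        refine and_congr Iff.rfl (and_congr ?_ ?_)
        · unfold PC; omega
        · refine forall_congr' fun k => forall_congr' fun hk => forall_congr' fun hk1 => ?_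
          exact Th_comm
      simp only [e1', e2, e1, if_false, hih2]; ring
  · have g1 : γ ∘ s = γ := sfix _ hxy.symm
    have e1' : ¬ TV i i1 γ σ σ' (σ i) (σ' i1) (γ i) (σ i1) (σ' i) (γ i1) := by
      rintro ⟨_, ⟨h1, h2, h3⟩, _⟩; unfold PC at h3; omega
    rw [g1] at hih2 ⊢
    simp only [e1', if_false]
    by_cases hv : Valid (j + 1) γ σ'
    swap
    · rw [← hih2, hf.inv _ _ hv]; simp
    by_cases huq : σ' i ≤ σ i1
    · have e2' : ¬ TV i i1 γ σ σ' (σ i1) (σ' i1) (γ i1) (σ i) (σ' i) (γ i) := by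
        rintro ⟨_, ⟨h1, h2, h3⟩, _⟩; unfold PC at h3; omega
      have e1 : TV i i1 γ σ σ' (σ i1) (σ' i) (γ i1) (σ i) (σ' i1) (γ i) ↔
          TV i i1 γ σ σ' (σ i) (σ' i) (γ i) (σ i1) (σ' i1) (γ i1) := by
        unfold TV
        refine and_congr_right fun O => (and_congr ?_ ?_)
        · unfold PC; omega
        · refine forall_congr' fun k => forall_congr' fun hk => forall_congr' fun hk1 => ?_
          rw [← hxy]
          exact (ar3 (vfacts hV i i1 k hk hk1).1 (vfacts hv i i1 k hk hk1).1 (O.1 k hk hk1)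
            (vfacts hV i i1 k hk hk1).2 (vfacts hv i i1 k hk hk1).2 hpq huv huq).symm
      simp only [e2', e1, if_false]; ring
    · have e2 : ¬ TV i i1 γ σ σ' (σ i1) (σ' i) (γ i1) (σ i) (σ' i1) (γ i) := by
        rintro ⟨_, ⟨h1, h2, h3⟩, _⟩; omega
      have e1 : TV i i1 γ σ σ' (σ i1) (σ' i1) (γ i1) (σ i) (σ' i) (γ i) ↔
          TV i i1 γ σ σ' (σ i) (σ' i) (γ i) (σ i1) (σ' i1) (γ i1) := by
        unfold TV
        refine and_congr Iff.rfl (and_congr ?_ ?_)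
        · unfold PC; omega
        · refine forall_congr' fun k => forall_congr' fun hk => forall_congr' fun hk1 => ?_
          exact Th_comm
      simp only [e2, e1, if_false, hih2]; ring
end trans3

set_option linter.unusedVariables false
section trans4
variable {n : ℕ}

theorem Th_zero {ab : Prop} {r r' z p u x : ℕ} {y y' : ℕ} :
    Th ab r r' z p u x 0 0 y ↔ Th ab r r' z p u x 0 0 y' := by
  unfold Th PC
  by_cases ab <;> simp only [*, true_imp_iff, not_true, not_false_iff, false_imp_iff, true_and, and_true] <;> omega

theorem Th_zero2 {ab : Prop} {r r' z : ℕ} {x x' y y' : ℕ} :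
    Th ab r r' z 0 0 x 0 0 y ↔ Th ab r r' z 0 0 x' 0 0 y' := by
  unfold Th PC
  by_cases ab <;> simp only [*, true_imp_iff, not_true, not_false_iff, false_imp_iff, true_and, and_true] <;> omega

set_option maxHeartbeats 1000000 in
theorem term1z {j : ℕ} {f : (Fin n → ℕ) → (Fin n → ℕ) → ℤ} (hf : SRel (j + 1) f) {i i1 : Fin n}
    (hi : i1.val = i.val + 1) {γ σ : Fin n → ℕ} (hV : Valid j γ σ)
    (A : Finset ℕ) (hpq : σ i1 < σ i) (hxy : γ i1 < γ i) (hq0 : σ i1 = 0) (σ' : Fin n → ℕ)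
    (huv : σ' i1 ≤ σ' i) :
    (tm A f γ σ σ' - tm A f (γ ∘ Equiv.swap i i1) (σ ∘ Equiv.swap i i1) σ') +
    (tm A f γ σ (σ' ∘ Equiv.swap i i1) -
      tm A f (γ ∘ Equiv.swap i i1) (σ ∘ Equiv.swap i i1) (σ' ∘ Equiv.swap i i1)) = 0 := by
  classical
  set s := Equiv.swap i i1 with hs
  have so : ∀ (τ : Fin n → ℕ) k, k ≠ i → k ≠ i1 → (τ ∘ s) k = τ k := fun τ k h1 h2 => by
    simp [hs, Equiv.swap_apply_of_ne_of_ne h1 h2]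
  have si : ∀ (τ : Fin n → ℕ), (τ ∘ s) i = τ i1 := fun τ => by simp [hs]
  have si1 : ∀ (τ : Fin n → ℕ), (τ ∘ s) i1 = τ i := fun τ => by simp [hs]
  have sr : ∀ (τ : Fin n → ℕ) k, k ≠ i → k ≠ i1 → τ k = τ k := fun _ _ _ _ => rfl
  have ss : ∀ (τ : Fin n → ℕ), (τ ∘ s) ∘ s = τ := fun τ => by ext k; simp [hs]
  have sfix : ∀ (τ : Fin n → ℕ), τ i1 = τ i → τ ∘ s = τ := fun τ h => by
    ext k
    by_cases hk : k = i
    · subst hk; rw [si, h]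
    by_cases hk1 : k = i1
    · subst hk1; rw [si1, h]
    exact so _ _ hk hk1
  have T1 := Tr_TV hi γ σ σ' γ σ σ' (sr _) (sr _) (sr _)
  have T2 := Tr_TV hi γ σ σ' (γ ∘ s) (σ ∘ s) σ' (so _) (so _) (sr _)
  have T1' := Tr_TV hi γ σ σ' γ σ (σ' ∘ s) (sr _) (sr _) (so _)
  have T2' := Tr_TV hi γ σ σ' (γ ∘ s) (σ ∘ s) (σ' ∘ s) (so _) (so _) (so _)
  simp only [si, si1] at T1 T2 T1' T2'
  simp only [tm, pset_swap, T1, T2, T1', T2']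
  by_cases hA : pset σ' = A
  swap
  · simp [hA]
  simp only [hA, and_true]
  have hp := hV.1 i
  have hq := hV.1 i1
  have e1 : TV i i1 γ σ σ' (σ i1) (σ' i1) (γ i1) (σ i) (σ' i) (γ i) ↔
      TV i i1 γ σ σ' (σ i) (σ' i) (γ i) (σ i1) (σ' i1) (γ i1) := by
    unfold TV
    refine and_congr Iff.rfl (and_congr ?_ ?_)
    · unfold PC; omega
    · refine forall_congr' fun k => forall_congr' fun hk => forall_congr' fun hk1 => ?_
      exact Th_comm
  simp only [e1]
  rcases huv.lt_or_eq with huv | huv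
  · have e2 : ¬ TV i i1 γ σ σ' (σ i1) (σ' i) (γ i1) (σ i) (σ' i1) (γ i) := by
      rintro ⟨_, ⟨h1, h2, h3⟩, _⟩; omega
    have e2' : ¬ TV i i1 γ σ σ' (σ i) (σ' i1) (γ i) (σ i1) (σ' i) (γ i1) := by
      rintro ⟨_, ⟨h1, h2, h3⟩, _⟩; omega
    simp only [e2, e2', if_false]
    have hih := hf.p1 i i1 hi γ σ' huv hxy
    rw [← hs] at hih
    have nv : ¬ Valid (j + 1) γ (σ' ∘ s) := by
      intro h
      have b1 := h.1 i1
      have b0 := h.1 i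
      rw [si1] at b1; rw [si] at b0
      omega
    rw [hf.inv _ _ nv] at hih
    have : f γ σ' = f (γ ∘ s) (σ' ∘ s) := by
      by_cases c : Cov i i1 γ σ'
      · simpa using hih.1 c
      · exact hih.2 c
    rw [this]; simp
  · have a1 : σ' ∘ s = σ' := sfix _ huv
    rw [a1]
    have b2 : i1 ≠ i := by intro h; rw [h] at hi; omega
    by_cases h0 : σ' i = 0
    · have := hf.p0 i i1 hi γ σ' h0 (by omega)
      rw [← hs] at this
      rw [huv] 
      rw [huv] at e1
      have e : TV i i1 γ σ σ' (σ i) (σ' i) (γ i) (σ i1) (σ' i) (γ i1) ↔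
        TV i i1 γ σ σ' (σ i1) (σ' i) (γ i1) (σ i) (σ' i) (γ i) := e1.symm
      simp only [e, ← this]; ring
    · have n1 : ∀ τ : Fin n → ℕ, ¬ Valid (j + 1) τ σ' := fun τ h => b2 (h.2 i1 i huv (by omega))
      rw [hf.inv _ _ (n1 _), hf.inv _ _ (n1 _)]; simp

theorem swap_lem {i i1 : Fin n} (σ : Fin n → ℕ) (g : (Fin n → ℕ) → ℤ)
    (h : ∀ σ' : Fin n → ℕ, σ' i1 ≤ σ' i → g σ' + g (σ' ∘ Equiv.swap i i1) = 0) (σ' : Fin n → ℕ) :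
    g σ' + g (σ' ∘ Equiv.swap i i1) = 0 := by
  rcases le_total (σ' i1) (σ' i) with h1 | h1
  · exact h _ h1
  · have := h (σ' ∘ Equiv.swap i i1) (by simpa using h1)
    have ss : (σ' ∘ Equiv.swap i i1) ∘ Equiv.swap i i1 = σ' := by ext k; simp
    rw [ss] at this; omega

theorem step_rel {j : ℕ} {f : (Fin n → ℕ) → (Fin n → ℕ) → ℤ} (hf : SRel (j + 1) f) (A : Finset ℕ) :
    SRel j (stepf j A f) := by
  classical
  refine ⟨fun γ σ h => by simp [stepf, h], ?_, ?_, ?_⟩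
  · intro i i1 hi γ σ h0 h1
    have sfix : σ ∘ Equiv.swap i i1 = σ := by
      ext k
      by_cases hk : k = i
      · subst hk; simp [h0, h1]
      by_cases hk1 : k = i1
      · subst hk1; simp [h0, h1]
      simp [Equiv.swap_apply_of_ne_of_ne hk hk1]
    have hv : Valid j (γ ∘ Equiv.swap i i1) σ ↔ Valid j γ σ := by
      conv_lhs => rw [← sfix]
      exact Valid_swap _
    unfold stepf
    simp only [hv]
    split_ifs with hV
    swap
    · rfl
    refine Finset.sum_congr rfl fun σ' _ => ?_
    unfold tm
    have so : ∀ (τ : Fin n → ℕ) k, k ≠ i → k ≠ i1 → (τ ∘ Equiv.swap i i1) k = τ k := fun τ k h1 h2 => by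
      simp [Equiv.swap_apply_of_ne_of_ne h1 h2]
    have T1 := Tr_TV hi γ σ σ' γ σ σ' (fun _ _ _ => rfl) (fun _ _ _ => rfl) (fun _ _ _ => rfl)
    have T2 := Tr_TV hi γ σ σ' (γ ∘ Equiv.swap i i1) σ σ' (so _) (fun _ _ _ => rfl) (fun _ _ _ => rfl)
    by_cases hz : σ' i = 0 ∧ σ' i1 = 0
    · have e : Tr (γ ∘ Equiv.swap i i1) σ σ' ↔ Tr γ σ σ' := by
        rw [T1, T2, h0, h1, hz.1, hz.2]
        unfold TV
        refine and_congr Iff.rfl (and_congr ?_ ?_)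
        · unfold PC; omega
        · refine forall_congr' fun k => forall_congr' fun hk => forall_congr' fun hk1 => ?_
          exact Th_zero2
      simp only [e]
      rw [hf.p0 i i1 hi γ σ' hz.1 hz.2]
    · have e1 : ∀ τ, ¬ Tr τ σ σ' := fun τ h => hz ⟨by have := h.1 i; omega, by have := h.1 i1; omega⟩
      simp [e1]
  · intro i i1 hi γ σ hpq hxy
    have hss : ∀ k, Equiv.swap i i1 (Equiv.swap i i1 k) = k := fun k => by simp
    by_cases hV : Valid j γ σ
    swap
    · have h2 : ¬ Valid j (γ ∘ Equiv.swap i i1) (σ ∘ Equiv.swap i i1) := by rwa [Valid_swap]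
      have h3 : ¬ Valid j γ (σ ∘ Equiv.swap i i1) ∨ 0 < σ i1 := by
        by_contra hc
        push Not at hc
        have b1 := hc.1.1 i1
        have b0 := hc.1.1 i
        simp at b1 b0
        omega
      have h4 : ¬ Valid j γ (σ ∘ Equiv.swap i i1) := by
        rcases h3 with h3 | h3
        · exact h3
        intro h5
        have b1 := h5.1 i1
        have b0 := h5.1 i
        simp at b1 b0
        apply hV
        have := (Valid_swap (j := j) (γ := γ) (σ := σ ∘ Equiv.swap i i1) (Equiv.swap i i1)).2 h5
        have ss : (σ ∘ Equiv.swap i i1) ∘ Equiv.swap i i1 = σ := by ext k; simp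
        rw [ss] at this
        refine ⟨fun k => ?_, this.2⟩
        by_cases hk : k = i
        · subst hk; omega
        by_cases hk1 : k = i1
        · subst hk1; omega
        have h9 := h5.1 k
        simpa [Equiv.swap_apply_of_ne_of_ne hk hk1] using h9
      simp [stepf, hV, h2, h4]
    have h2 : Valid j (γ ∘ Equiv.swap i i1) (σ ∘ Equiv.swap i i1) := by rwa [Valid_swap]
    have hp := hV.1 i
    have hq := hV.1 i1
    by_cases hq0 : 0 < σ i1
    · have h3 : Valid j γ (σ ∘ Equiv.swap i i1) := by
        refine ⟨fun k => ?_, h2.2⟩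
        by_cases hk : k = i
        · subst hk; simp; omega
        by_cases hk1 : k = i1
        · subst hk1; simp; omega
        have h9 := hV.1 k
        simpa [Equiv.swap_apply_of_ne_of_ne hk hk1] using h9
      have := fun cov hc => sum_pair (insert 0 A) (Equiv.swap i i1) hss _
        (swap_lem (i := i) (i1 := i1) σ (fun σ' => tm A f γ σ σ' - tm A f (γ ∘ Equiv.swap i i1) (σ ∘ Equiv.swap i i1) σ' -
      cov * tm A f γ (σ ∘ Equiv.swap i i1) σ')
          (fun σ' h => term1 hf hi hV A hpq hxy hq0 σ' h cov hc))
      simp only [stepf, hV, h2, h3, if_true]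
      simp only [Finset.sum_sub_distrib, ← Finset.mul_sum] at this
      constructor
      · intro hc
        have := this 1 (by simp [hc])
        linarith
      · intro hc
        have := this 0 (by simp [hc])
        linarith
    · have h3 : ¬ Valid j γ (σ ∘ Equiv.swap i i1) := by
        intro h
        have b1 := h.1 i
        simp at b1
        omega
      have := sum_pair (insert 0 A) (Equiv.swap i i1) hss _
        (swap_lem (i := i) (i1 := i1) σ (fun σ' => tm A f γ σ σ' - tm A f (γ ∘ Equiv.swap i i1) (σ ∘ Equiv.swap i i1) σ')
          (fun σ' h => term1z hf hi hV A hpq hxy (by omega) σ' h))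
      simp only [stepf, hV, h2, h3, if_true, if_false]
      simp only [Finset.sum_sub_distrib, ← Finset.mul_sum] at this
      constructor <;> intro _ <;> linarith
  · intro i i1 hi γ σ hpq hxy
    have hss : ∀ k, Equiv.swap i i1 (Equiv.swap i i1 k) = k := fun k => by simp
    by_cases hV : Valid j γ σ
    swap
    · have h2 : ¬ Valid j (γ ∘ Equiv.swap i i1) (σ ∘ Equiv.swap i i1) := by rwa [Valid_swap]
      simp [stepf, hV, h2]
    have h2 : Valid j (γ ∘ Equiv.swap i i1) (σ ∘ Equiv.swap i i1) := by rwa [Valid_swap]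
    have := sum_pair (insert 0 A) (Equiv.swap i i1) hss _
        (swap_lem (i := i) (i1 := i1) σ (fun σ' => tm A f γ σ σ' - tm A f (γ ∘ Equiv.swap i i1) (σ ∘ Equiv.swap i i1) σ')
          (fun σ' h => term2 hf hi hV A hpq hxy σ' h))
    simp only [stepf, hV, h2, if_true]
    simp only [Finset.sum_sub_distrib, ← Finset.mul_sum] at this
    linarith

theorem NN_rel (A : ℕ → Finset ℕ) (m : ℕ) : ∀ j, SRel j (NN (n := n) A m j) := by
  classical
  induction m with
  | zero =>
    intro j
    refine ⟨fun γ σ h => NN_invalid h, ?_, ?_, ?_⟩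
    · intro i i1 hi γ σ h0 h1
      have sfix : σ ∘ Equiv.swap i i1 = σ := by
        ext k
        by_cases hk : k = i
        · subst hk; simp [h0, h1]
        by_cases hk1 : k = i1
        · subst hk1; simp [h0, h1]
        simp [Equiv.swap_apply_of_ne_of_ne hk hk1]
      have hv : Valid j (γ ∘ Equiv.swap i i1) σ ↔ Valid j γ σ := by
        conv_lhs => rw [← sfix]
        exact Valid_swap _
      simp [NN, hv]
    · intro i i1 hi γ σ hpq hxy
      have a1 : ¬ ∀ k, σ k = 0 := fun h => by have := h i; omega
      have a2 : ¬ ∀ k, σ (Equiv.swap i i1 k) = 0 := fun h => by have := h i1; simp at this; omega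
      simp [NN, a1, a2]
    · intro i i1 hi γ σ hpq hxy
      have a1 : ¬ ∀ k, σ k = 0 := fun h => by have := h i; omega
      have a2 : ¬ ∀ k, σ (Equiv.swap i i1 k) = 0 := fun h => by have := h i1; simp at this; omega
      simp [NN, a1, a2]
  | succ m ih =>
    intro j
    have : NN (n := n) A (m + 1) j = stepf j (A (j + 1)) (NN A m (j + 1)) := by
      ext γ σ
      simp only [NN, stepf, tm]
    rw [this]
    exact step_rel (ih _) _
end trans4

set_option linter.unusedVariables false
set_option linter.unusedSimpArgs false
section lists
def gL (n : ℕ) (L : List (ℕ × ℕ)) : Fin n → ℕ := fun i => (L.getD i (0, 0)).2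
def sL (n : ℕ) (L : List (ℕ × ℕ)) : Fin n → ℕ := fun i => (L.getD i (0, 0)).1
def ev {n : ℕ} (f : (Fin n → ℕ) → (Fin n → ℕ) → ℤ) (L : List (ℕ × ℕ)) : ℤ := f (gL n L) (sL n L)

theorem getD_mid {α : Type*} (X Y : List α) (a b d : α) (k : ℕ) :
    (X ++ a :: b :: Y).getD k d = if k < X.length then X.getD k d else if k = X.length then a else
      if k = X.length + 1 then b else Y.getD (k - X.length - 2) d := by
  split_ifs with h1 h2 h3
  · rw [List.getD_append _ _ _ _ h1]
  · subst h2; rw [List.getD_append_right _ _ _ _ (le_refl _)]; simp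
  · subst h3; rw [List.getD_append_right _ _ _ _ (by omega)]; simp
  · rw [List.getD_append_right _ _ _ _ (by omega)]
    obtain ⟨m, hm⟩ : ∃ m, k - X.length = m + 2 := ⟨k - X.length - 2, by omega⟩
    rw [hm]; simp

theorem swapL {n : ℕ} (X Y : List (ℕ × ℕ)) (a b : ℕ × ℕ) (g : ℕ × ℕ → ℕ) (i i1 : Fin n)
    (hi : i.val = X.length) (hi1 : i1.val = X.length + 1) :
    (fun k : Fin n => g ((X ++ a :: b :: Y).getD k (0, 0))) ∘ Equiv.swap i i1 =
    (fun k : Fin n => g ((X ++ b :: a :: Y).getD k (0, 0))) := by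
  ext k
  simp only [Function.comp]
  by_cases hk : k = i
  · subst hk; simp only [Equiv.swap_apply_left, getD_mid, hi, hi1]; simp
  by_cases hk1 : k = i1
  · subst hk1; simp only [Equiv.swap_apply_right, getD_mid, hi, hi1]; simp
  have a1 : k.val ≠ X.length := fun h => hk (Fin.ext (by omega))
  have a2 : k.val ≠ X.length + 1 := fun h => hk1 (Fin.ext (by omega))
  rw [Equiv.swap_apply_of_ne_of_ne hk hk1]
  simp only [getD_mid, a1, a2, if_false]

theorem R2 {n : ℕ} {f : (Fin n → ℕ) → (Fin n → ℕ) → ℤ} {j : ℕ} (hf : SRel j f) (X Y : List (ℕ × ℕ))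
    (p x q y : ℕ) (hl : X.length + Y.length + 2 = n) (hpq : q < p) (hxy : x ≤ y) :
    ev f (X ++ (p, x) :: (q, y) :: Y) = ev f (X ++ (q, y) :: (p, x) :: Y) := by
  let i : Fin n := ⟨X.length, by omega⟩
  let i1 : Fin n := ⟨X.length + 1, by omega⟩
  have := hf.p2 i i1 rfl (gL n (X ++ (p, x) :: (q, y) :: Y)) (sL n (X ++ (p, x) :: (q, y) :: Y))
    (by simp [sL, getD_mid, i, i1, hpq]) (by simp [gL, getD_mid, i, i1, hxy])
  unfold gL sL at this
  rw [swapL _ _ _ _ Prod.fst i i1 rfl rfl, swapL _ _ _ _ Prod.snd i i1 rfl rfl] at this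
  exact this

theorem R1 {n : ℕ} {f : (Fin n → ℕ) → (Fin n → ℕ) → ℤ} {j : ℕ} (hf : SRel j f) (X Y : List (ℕ × ℕ))
    (p x q y : ℕ) (hl : X.length + Y.length + 2 = n) (hpq : q < p) (hxy : y < x)
    (hX : ∀ w ∈ X, w.1 < q ∨ p < w.1) (hY : ∀ w ∈ Y, q < w.1 ∧ w.1 < p) :
    ev f (X ++ (p, x) :: (q, y) :: Y) = ev f (X ++ (q, y) :: (p, x) :: Y) +
      if (∀ w ∈ Y, ¬ (y < w.2 ∧ w.2 ≤ x)) then ev f (X ++ (q, x) :: (p, y) :: Y) else 0 := by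
  let i : Fin n := ⟨X.length, by omega⟩
  let i1 : Fin n := ⟨X.length + 1, by omega⟩
  have := hf.p1 i i1 rfl (gL n (X ++ (p, x) :: (q, y) :: Y)) (sL n (X ++ (p, x) :: (q, y) :: Y))
    (by simp [sL, getD_mid, i, i1, hpq]) (by simp [gL, getD_mid, i, i1, hxy])
  have cv : Cov i i1 (gL n (X ++ (p, x) :: (q, y) :: Y)) (sL n (X ++ (p, x) :: (q, y) :: Y)) ↔
      (∀ w ∈ Y, ¬ (y < w.2 ∧ w.2 ≤ x)) := by
    have ei : sL n (X ++ (p, x) :: (q, y) :: Y) i = p := by simp [sL, getD_mid, i]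
    have ei1 : sL n (X ++ (p, x) :: (q, y) :: Y) i1 = q := by simp [sL, getD_mid, i1]
    have fi : gL n (X ++ (p, x) :: (q, y) :: Y) i = x := by simp [gL, getD_mid, i]
    have fi1 : gL n (X ++ (p, x) :: (q, y) :: Y) i1 = y := by simp [gL, getD_mid, i1]
    unfold Cov
    rw [ei, ei1, fi, fi1]
    constructor
    · intro h w hw
      obtain ⟨m, hm, rfl⟩ := List.mem_iff_getElem.1 hw
      have e : (X ++ (p, x) :: (q, y) :: Y).getD (X.length + 2 + m) (0, 0) = Y[m] := by
        rw [getD_mid, if_neg (by omega), if_neg (by omega), if_neg (by omega)]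
        rw [show X.length + 2 + m - X.length - 2 = m by omega, List.getD_eq_getElem _ _ hm]
      have hlt : X.length + 2 + m < n := by omega
      have := (h ⟨X.length + 2 + m, hlt⟩ (by simp [i, Fin.ext_iff]; omega) (by simp [i1, Fin.ext_iff]; omega)).2
        (by simp [i, Fin.lt_def]; omega)
      simp only [gL, sL, e] at this
      have := hY _ hw
      omega
    · intro h k hk hk1
      have a1 : k.val ≠ X.length := fun h => hk (Fin.ext (by simpa [i] using h))
      have a2 : k.val ≠ X.length + 1 := fun h => hk1 (Fin.ext (by simpa [i1] using h))
      constructor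
      · intro hki
        have hki : k.val < X.length := hki
        have e : (X ++ (p, x) :: (q, y) :: Y).getD k (0, 0) = X[k.val] := by
          rw [getD_mid, if_pos hki, List.getD_eq_getElem _ _ hki]
        simp only [gL, sL, e]
        have := hX X[k.val] (List.getElem_mem _)
        omega
      · intro hki
        have hki : ¬ k.val < X.length := hki
        have hl2 : k.val - X.length - 2 < Y.length := by have := k.2; omega
        have e : (X ++ (p, x) :: (q, y) :: Y).getD k (0, 0) = Y[k.val - X.length - 2] := by
          rw [getD_mid, if_neg (by omega), if_neg (by omega), if_neg (by omega), List.getD_eq_getElem _ _ hl2]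
        simp only [gL, sL, e]
        have := h Y[k.val - X.length - 2] (List.getElem_mem _)
        omega
  rw [cv] at this
  unfold gL sL at this
  rw [swapL _ _ _ _ Prod.fst i i1 rfl rfl, swapL _ _ _ _ Prod.snd i i1 rfl rfl] at this
  have e3 : ev f (X ++ (q, x) :: (p, y) :: Y) = f (fun k => ((X ++ (p, x) :: (q, y) :: Y).getD k (0, 0)).2)
      (fun k => ((X ++ (q, y) :: (p, x) :: Y).getD k (0, 0)).1) := by
    unfold ev gL sL
    congr 1
    · ext k; simp only [getD_mid]; split_ifs <;> rfl
    · ext k; simp only [getD_mid]; split_ifs <;> rfl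
  rw [e3]
  split_ifs with hc
  · exact this.1 hc
  · rw [add_zero]; exact this.2 hc

def DD : List ℕ → ℕ → List (List ℕ)
  | [], z => [[z]]
  | c :: Q, z => (DD Q z).map (fun d => c :: d) ++
      (if c < z ∧ ∀ e ∈ Q, ¬ (c < e ∧ e ≤ z) then (DD Q c).map (fun d => z :: d) else [])

def zipv : ℕ → List ℕ → List (ℕ × ℕ)
  | _, [] => []
  | q, c :: Q => (q, c) :: zipv (q + 1) Q

theorem zipv_length (Q : List ℕ) : ∀ q, (zipv q Q).length = Q.length := by
  induction Q with
  | nil => intro q; rfl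
  | cons c Q ih => intro q; simp [zipv, ih]

theorem zipv_mem (Q : List ℕ) : ∀ q, ∀ w ∈ zipv q Q, q ≤ w.1 ∧ w.1 < q + Q.length ∧ w.2 ∈ Q := by
  induction Q with
  | nil => intro q w hw; simp [zipv] at hw
  | cons c Q ih =>
    intro q w hw
    simp only [zipv, List.mem_cons] at hw
    rcases hw with rfl | hw
    · simp
    · have := ih _ _ hw
      simp only [List.length_cons, List.mem_cons]
      refine ⟨by omega, by omega, Or.inr this.2.2⟩

theorem zipv_mem2 (Q : List ℕ) : ∀ q, ∀ e ∈ Q, ∃ w ∈ zipv q Q, w.2 = e := by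
  induction Q with
  | nil => intro q w hw; simp at hw
  | cons c Q ih =>
    intro q e he
    rcases List.mem_cons.1 he with rfl | he
    · exact ⟨(q, e), by simp [zipv], rfl⟩
    · obtain ⟨w, hw, h⟩ := ih (q + 1) e he
      exact ⟨w, by simp [zipv, hw], h⟩

theorem move {n : ℕ} {f : (Fin n → ℕ) → (Fin n → ℕ) → ℤ} {j : ℕ} (hf : SRel j f) (Q : List ℕ) :
    ∀ (q z : ℕ) (W : List (ℕ × ℕ)), W.length + Q.length + 1 = n →
    (∀ w ∈ W, w.1 < q ∨ q + Q.length < w.1) →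
    ev f (W ++ (q + Q.length, z) :: zipv q Q) = ((DD Q z).map (fun d => ev f (W ++ zipv q d))).sum := by
  induction Q with
  | nil => intro q z W hl hW; simp [DD, zipv]
  | cons c Q ih =>
    intro q z W hl hW
    simp only [List.length_cons] at hl hW ⊢
    have hY : ∀ w ∈ zipv (q + 1) Q, q < w.1 ∧ w.1 < q + (Q.length + 1) := fun w hw => by
      have := zipv_mem Q _ w hw; omega
    have e1 : ∀ z t, ev f (W ++ (q, t) :: (q + (Q.length + 1), z) :: zipv (q + 1) Q) =
        (((DD Q z).map (fun d => t :: d)).map (fun d => ev f (W ++ zipv q d))).sum := by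
      intro z t
      have := ih (q + 1) z (W ++ [(q, t)]) (by simp; omega) (by
        intro w hw
        rcases List.mem_append.1 hw with hw | hw
        · have := hW w hw; omega
        · simp at hw; subst hw; left; simp)
      rw [show q + 1 + Q.length = q + (Q.length + 1) by omega] at this
      simp only [List.append_assoc, List.singleton_append] at this
      rw [this, List.map_map]
      rfl
    simp only [zipv, DD, List.map_append, List.sum_append]
    by_cases hz : c < z
    · rw [R1 hf _ _ _ _ _ _ (by rw [zipv_length]; omega) (by omega) hz hW hY, e1]
      congr 1
      have : (∀ w ∈ zipv (q + 1) Q, ¬(c < w.2 ∧ w.2 ≤ z)) ↔ ∀ e ∈ Q, ¬ (c < e ∧ e ≤ z) := by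
        constructor
        · intro h e he
          obtain ⟨w, hw, rfl⟩ := zipv_mem2 Q (q + 1) e he
          exact h w hw
        · intro h w hw
          exact h _ (zipv_mem Q _ w hw).2.2
      simp only [this, hz, true_and]
      split_ifs with h
      · exact e1 _ _
      · simp
    · rw [R2 hf _ _ _ _ _ _ (by rw [zipv_length]; omega) (by omega) (by omega), e1]
      simp [hz]

def zrr : List ℕ → List (ℕ × ℕ)
  | [] => []
  | z :: r => (r.length + 1, z) :: zrr r

def LSr : List ℕ → List (List ℕ)
  | [] => [[]]
  | z :: r => (LSr r).flatMap (fun c => DD c z)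

theorem zrr_length (r : List ℕ) : (zrr r).length = r.length := by
  induction r with
  | nil => rfl
  | cons z r ih => simp [zrr, ih]

theorem DD_perm (Q : List ℕ) : ∀ z, ∀ d ∈ DD Q z, d.Perm (z :: Q) := by
  induction Q with
  | nil => intro z d hd; simp [DD] at hd; subst hd; exact List.Perm.refl _
  | cons c Q ih =>
    intro z d hd
    simp only [DD, List.mem_append, List.mem_map] at hd
    rcases hd with ⟨e, he, rfl⟩ | hd
    · exact ((ih _ _ he).cons c).trans (List.Perm.swap _ _ _)
    · split_ifs at hd
      · obtain ⟨e, he, rfl⟩ := List.mem_map.1 hd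
        exact ((ih _ _ he).cons z)
      · simp at hd

theorem LSr_perm (r : List ℕ) : ∀ d ∈ LSr r, d.Perm r := by
  induction r with
  | nil => intro d hd; simp [LSr] at hd; subst hd; exact List.Perm.refl _
  | cons z r ih =>
    intro d hd
    simp only [LSr, List.mem_flatMap] at hd
    obtain ⟨c, hc, hd⟩ := hd
    exact (DD_perm _ _ _ hd).trans ((ih _ hc).cons z)

theorem sum_flatMap' {α : Type*} (l : List α) (g : α → List (List ℕ)) (h : List ℕ → ℤ) :
    ((l.flatMap g).map h).sum = (l.map (fun c => ((g c).map h).sum)).sum := by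
  induction l with
  | nil => simp
  | cons a l ih => simp [ih]

theorem zrr_sum {n : ℕ} {f : (Fin n → ℕ) → (Fin n → ℕ) → ℤ} {j : ℕ} (hf : SRel j f) (r : List ℕ) :
    ∀ (W : List (ℕ × ℕ)), W.length + r.length = n → (∀ w ∈ W, r.length < w.1) →
    ev f (W ++ zrr r) = ((LSr r).map (fun d => ev f (W ++ zipv 1 d))).sum := by
  induction r with
  | nil => intro W _ _; simp [zrr, LSr, zipv]
  | cons z r ih =>
    intro W hl hW
    simp only [List.length_cons] at hl hW
    have := ih (W ++ [(r.length + 1, z)]) (by simp; omega) (by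
        intro w hw
        rcases List.mem_append.1 hw with hw | hw
        · have := hW w hw; omega
        · simp at hw; subst hw; simp)
    simp only [List.append_assoc, List.singleton_append] at this
    simp only [zrr]
    rw [this, LSr, sum_flatMap']
    congr 1
    refine List.map_congr_left fun c hc => ?_
    have hcl := (LSr_perm _ _ hc).length_eq
    have := move hf c 1 z W (by omega) (fun w hw => by have := hW w hw; omega)
    rw [← this]
    rw [hcl, add_comm 1]
end lists

set_option linter.unusedVariables false
set_option linter.unusedSimpArgs false
section crit
def cnt (t : ℕ) (l : List ℕ) : ℕ := l.countP (fun x => decide (t ≤ x))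
theorem cnt_nil (t : ℕ) : cnt t [] = 0 := rfl
theorem cnt_cons (t x : ℕ) (l : List ℕ) : cnt t (x :: l) = cnt t l + if t ≤ x then 1 else 0 := by
  unfold cnt; rw [List.countP_cons]; simp
theorem cnt_append (t : ℕ) (l m : List ℕ) : cnt t (l ++ m) = cnt t l + cnt t m := by
  unfold cnt; rw [List.countP_append]
theorem cnt_perm (t : ℕ) {l m : List ℕ} (h : l.Perm m) : cnt t l = cnt t m := h.countP_eq _
theorem cnt_anti {s t : ℕ} (h : s ≤ t) (l : List ℕ) : cnt t l ≤ cnt s l := by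
  unfold cnt; apply List.countP_mono_left; intro x _ hx; simp at *; omega
theorem cnt_gap {s t : ℕ} (h : s ≤ t) (l : List ℕ) (hg : ∀ e ∈ l, ¬ (s ≤ e ∧ e < t)) : cnt t l = cnt s l := by
  unfold cnt; apply List.countP_congr; intro x hx; have := hg x hx; simp; omega

def Crit (a d : List ℕ) : Prop := d.Perm a ∧ ∀ t k, cnt t (a.take k) ≤ cnt t (d.take k)

theorem Crit.refl (a : List ℕ) : Crit a a := ⟨List.Perm.refl _, fun _ _ => le_refl _⟩
theorem Crit.trans {a b c : List ℕ} (h : Crit a b) (h' : Crit b c) : Crit a c :=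
  ⟨h'.1.trans h.1, fun t k => (h.2 t k).trans (h'.2 t k)⟩
theorem Crit.cons {a d : List ℕ} (x : ℕ) (h : Crit a d) : Crit (x :: a) (x :: d) := by
  refine ⟨h.1.cons x, fun t k => ?_⟩
  cases k with
  | zero => simp
  | succ k => simp only [List.take_succ_cons, cnt_cons]; have := h.2 t k; omega
theorem Crit.of_cons {a d : List ℕ} {x : ℕ} (h : Crit (x :: a) (x :: d)) : Crit a d := by
  refine ⟨(List.perm_cons x).1 h.1, fun t k => ?_⟩
  have := h.2 t (k + 1)
  simp only [List.take_succ_cons, cnt_cons] at this; omega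

theorem Crit.swap0 {u v : ℕ} (h : u ≤ v) (Y Z : List ℕ) : Crit (u :: (Y ++ v :: Z)) (v :: (Y ++ u :: Z)) := by
  constructor
  · rw [List.perm_iff_count]; intro a; simp [List.count_cons]; omega
  · intro t k
    cases k with
    | zero => simp
    | succ k =>
      simp only [List.take_succ_cons, List.take_append, cnt_cons, cnt_append]
      cases k - Y.length with
      | zero => simp; split_ifs <;> omega
      | succ k => simp only [List.take_succ_cons, cnt_cons]; omega

theorem step_decomp {a b : List ℕ} (h : LSwapStep a b) : ∃ X u Y v Z, u ≤ v ∧ a = X ++ u :: (Y ++ v :: Z) ∧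
    b = X ++ v :: (Y ++ u :: Z) := by
  obtain ⟨i, j, hij, hj, hle, rfl⟩ := h
  have hi : i < a.length := by omega
  rw [List.getD_eq_getElem _ _ hi, List.getD_eq_getElem _ _ hj] at hle ⊢
  have e1 : a = a.take i ++ a[i] :: ((a.drop (i+1)).take (j - i - 1) ++ a[j] :: a.drop (j + 1)) := by
    have h1 : a = a.take i ++ a.drop i := (List.take_append_drop _ _).symm
    have h2 : a.drop i = a[i] :: a.drop (i + 1) := List.drop_eq_getElem_cons hi
    have h3 : a.drop (i+1) = (a.drop (i+1)).take (j - i - 1) ++ (a.drop (i+1)).drop (j - i - 1) :=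
      (List.take_append_drop _ _).symm
    have h4 : (a.drop (i+1)).drop (j - i - 1) = a.drop j := by rw [List.drop_drop]; congr 1; omega
    have h5 : a.drop j = a[j] :: a.drop (j + 1) := List.drop_eq_getElem_cons hj
    rw [h4, h5] at h3
    rw [← h3, ← h2]; exact h1
  refine ⟨a.take i, a[i], (a.drop (i+1)).take (j - i - 1), a[j], a.drop (j + 1), hle, e1, ?_⟩
  generalize a[i] = u at *
  generalize a[j] = v at *
  have l1 : (a.take i).length = i := by simp; omega
  have l2 : ((a.drop (i+1)).take (j - i - 1)).length = j - i - 1 := by simp; omega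
  generalize a.take i = X at *
  generalize (a.drop (i+1)).take (j - i - 1) = Y at *
  generalize a.drop (j+1) = Z at *
  subst e1
  rw [List.set_append, if_neg (by omega), l1, Nat.sub_self, List.set_cons_zero,
    List.set_append, if_neg (by omega), l1]
  rw [show j - i = (j - i - 1) + 1 by omega, List.set_cons_succ, List.set_append, if_neg (by omega), l2]
  simp

theorem step_of {X Y Z : List ℕ} {u v : ℕ} (h : u ≤ v) :
    LSwapStep (X ++ u :: (Y ++ v :: Z)) (X ++ v :: (Y ++ u :: Z)) := by
  refine ⟨X.length, X.length + 1 + Y.length, by omega, by simp; omega, ?_, ?_⟩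
  · rw [List.getD_append_right _ _ _ _ (by omega), List.getD_append_right _ _ _ _ (by omega)]
    rw [show X.length + 1 + Y.length - X.length = Y.length + 1 by omega]
    simpa using h
  · rw [List.getD_append_right _ _ _ _ (by omega), List.getD_append_right _ _ _ _ (by omega)]
    rw [show X.length + 1 + Y.length - X.length = Y.length + 1 by omega]
    simp [List.set_append, show X.length + 1 + Y.length - X.length = Y.length + 1 by omega]
    intro h; omega

theorem Crit.prepend {a d : List ℕ} (X : List ℕ) (h : Crit a d) : Crit (X ++ a) (X ++ d) := by
  induction X with
  | nil => exact h
  | cons x X ih => exact ih.cons x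

theorem lswap_crit {a d : List ℕ} (h : d ∈ lswapSet a) : Crit a d := by
  induction h with
  | refl => exact Crit.refl _
  | tail _ h ih =>
    obtain ⟨X, u, Y, v, Z, hle, rfl, rfl⟩ := step_decomp h
    exact ih.trans ((Crit.swap0 hle Y Z).prepend X)

theorem lswap_cons {a d : List ℕ} (x : ℕ) (h : d ∈ lswapSet a) : x :: d ∈ lswapSet (x :: a) := by
  induction h with
  | refl => exact Relation.ReflTransGen.refl
  | tail _ h ih =>
    obtain ⟨X, u, Y, v, Z, hle, rfl, rfl⟩ := step_decomp h
    exact ih.tail (step_of (X := x :: X) hle)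

theorem first_split (P : ℕ → Prop) (l : List ℕ) (h : ∃ e ∈ l, P e) :
    ∃ Y v Z, l = Y ++ v :: Z ∧ P v ∧ ∀ e ∈ Y, ¬ P e := by
  induction l with
  | nil => simp at h
  | cons x l ih =>
    by_cases hx : P x
    · exact ⟨[], x, l, rfl, hx, by simp⟩
    · obtain ⟨e, he, hp⟩ := h
      rcases List.mem_cons.1 he with rfl | he
      · exact absurd hp hx
      obtain ⟨Y, v, Z, rfl, h1, h2⟩ := ih ⟨e, he, hp⟩
      refine ⟨x :: Y, v, Z, rfl, h1, ?_⟩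
      intro e he
      rcases List.mem_cons.1 he with rfl | he
      · exact hx
      · exact h2 e he

theorem crit_lswap (d : List ℕ) : ∀ a, Crit a d → d ∈ lswapSet a := by
  induction d with
  | nil => intro a h; rw [h.1.symm.eq_nil]; exact Relation.ReflTransGen.refl
  | cons y d ih =>
    have main : ∀ m x a, y - x ≤ m → Crit (x :: a) (y :: d) → (y :: d) ∈ lswapSet (x :: a) := by
      intro m
      induction m with
      | zero =>
        intro x a hm h
        have h1 := h.2 x 1
        simp only [List.take_succ_cons, List.take_zero, cnt_cons, cnt_nil, le_refl, if_true] at h1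
        have : x = y := by by_contra hne; rw [if_neg (by omega)] at h1; omega
        subst this
        exact lswap_cons _ (ih _ h.of_cons)
      | succ m ihm =>
        intro x a hm h
        have h1 := h.2 x 1
        simp only [List.take_succ_cons, List.take_zero, cnt_cons, cnt_nil, le_refl, if_true] at h1
        have hxy : x ≤ y := by by_contra hne; rw [if_neg (by omega)] at h1; omega
        rcases hxy.eq_or_lt with rfl | hxy
        · exact lswap_cons _ (ih _ h.of_cons)
        have hy : y ∈ a := by
          have := h.1.subset (List.mem_cons_self)
          rcases List.mem_cons.1 this with h | h
          · omega
          · exact h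
        obtain ⟨Y, v, Z, rfl, hv, hY⟩ := first_split (fun e => x < e ∧ e ≤ y) a ⟨y, hy, hxy, le_refl _⟩
        have hstep : LSwapStep (x :: (Y ++ v :: Z)) (v :: (Y ++ x :: Z)) := step_of (X := []) hv.1.le
        refine Relation.ReflTransGen.head hstep (ihm v _ (by omega) ⟨h.1.trans (Crit.swap0 hv.1.le Y Z).1.symm, ?_⟩)
        intro t k
        have hk := h.2 t k
        cases k with
        | zero => simp
        | succ k =>
          have hk2 := h.2 (y + 1) (k + 1)
          simp only [List.take_succ_cons, List.take_append, cnt_cons, cnt_append] at hk hk2 ⊢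
          by_cases ht : x < t ∧ t ≤ v
          swap
          · cases hkk : k - Y.length with
            | zero => rw [hkk] at hk; simp [cnt_nil] at hk ⊢; split_ifs at hk ⊢ <;> omega
            | succ k => rw [hkk] at hk; simp only [List.take_succ_cons, cnt_cons] at hk ⊢; split_ifs at hk ⊢ <;> omega
          have g1 : cnt (y + 1) (Y.take k) = cnt t (Y.take k) := cnt_gap (by omega) _ (fun e he => by
            have := hY e (List.mem_of_mem_take he); omega)
          have g2 := cnt_anti (show t ≤ y + 1 by omega) (d.take k)
          rw [if_neg (by omega), if_neg (by omega)] at hk2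
          rw [if_pos (by omega), if_pos (by omega)]
          rw [if_neg (by omega), if_pos (by omega)] at hk
          cases hkk : k - Y.length with
          | zero => rw [hkk] at hk hk2; simp only [List.take_zero, cnt_nil] at hk hk2 ⊢; omega
          | succ k' =>
            rw [hkk] at hk hk2; simp only [List.take_succ_cons, cnt_cons] at hk hk2 ⊢
            rw [if_pos (by omega)] at hk
            rw [if_neg (by omega)]; omega
    intro a h
    cases a with
    | nil => exact absurd h.1.eq_nil (by simp)
    | cons x a => exact main _ x a le_rfl h

theorem lswap_iff {a d : List ℕ} : d ∈ lswapSet a ↔ Crit a d := ⟨lswap_crit, crit_lswap _ _⟩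
end crit

set_option linter.unusedVariables false
set_option linter.unusedSimpArgs false
section dd
theorem DD_lswap (c : List ℕ) : ∀ z, ∀ d ∈ DD c z, d ∈ lswapSet (c ++ [z]) := by
  induction c with
  | nil => intro z d hd; simp [DD] at hd; subst hd; exact Relation.ReflTransGen.refl
  | cons x Q ih =>
    intro z d hd
    simp only [DD, List.mem_append, List.mem_map] at hd
    rcases hd with ⟨e, he, rfl⟩ | hd
    · exact lswap_cons _ (ih _ _ he)
    · split_ifs at hd with hc
      · obtain ⟨e, he, rfl⟩ := List.mem_map.1 hd
        exact Relation.ReflTransGen.head (step_of (X := []) (Y := Q) (Z := []) hc.1.le) (lswap_cons _ (ih _ _ he))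
      · simp at hd

theorem DD_B (c : List ℕ) : ∀ z, ∀ d ∈ DD c z, ∀ k ≤ c.length, ∃ y ≤ z,
    (∀ t, cnt t (d.take k) = cnt t (c.take k) + if y < t ∧ t ≤ z then 1 else 0) ∧
    ∀ e ∈ d.drop k, ¬ (y < e ∧ e ≤ z) := by
  induction c with
  | nil => 
    intro z d hd k hk
    have : k = 0 := by simpa using hk
    subst this
    exact ⟨z, le_rfl, fun t => by simp, fun e _ => by omega⟩
  | cons x Q ih =>
    intro z d hd k hk
    cases k with
    | zero => exact ⟨z, le_rfl, fun t => by simp, fun e _ => by omega⟩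
    | succ k =>
      have hk' : k ≤ Q.length := by simpa using hk
      simp only [DD, List.mem_append, List.mem_map] at hd
      rcases hd with ⟨e, he, rfl⟩ | hd
      · obtain ⟨y, hy, h1, h2⟩ := ih z e he k hk'
        refine ⟨y, hy, fun t => ?_, by simpa using h2⟩
        simp only [List.take_succ_cons, cnt_cons, h1 t]; omega
      · split_ifs at hd with hc
        · obtain ⟨e, he, rfl⟩ := List.mem_map.1 hd
          obtain ⟨y, hy, h1, h2⟩ := ih x e he k hk'
          refine ⟨y, by omega, fun t => ?_, ?_⟩
          · simp only [List.take_succ_cons, cnt_cons, h1 t]; split_ifs <;> omega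
          · intro w hw
            simp only [List.drop_succ_cons] at hw
            have a1 := h2 w hw
            have a2 := (DD_perm _ _ _ he).subset (List.mem_of_mem_drop hw)
            rcases List.mem_cons.1 a2 with h | h
            · omega
            · have := hc.2 w h; omega
        · simp at hd

theorem DD_crit {a c d : List ℕ} {z : ℕ} (hd : d ∈ DD c z) (h : Crit (a ++ [z]) d) : Crit a c := by
  have hp : c.Perm a := by
    have := (DD_perm _ _ _ hd).symm.trans (h.1.trans (List.perm_append_singleton z a))
    exact (List.perm_cons z).1 this
  refine ⟨hp, fun t k => ?_⟩
  by_cases hk : a.length ≤ k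
  · rw [List.take_of_length_le hk, List.take_of_length_le (by rw [hp.length_eq]; exact hk), cnt_perm t hp]
  obtain ⟨y, hy, h1, h2⟩ := DD_B c z d hd k (by rw [hp.length_eq]; omega)
  have h3 := h1 t
  have h4 := h.2 t k
  rw [List.take_append_of_le_length (by omega)] at h4
  split_ifs at h3 with ht
  swap
  · omega
  have g1 : cnt (z + 1) (d.drop k) = cnt t (d.drop k) := cnt_gap (by omega) _ (fun e he => by
    have := h2 e he; omega)
  have t1 : ∀ t, cnt t d = cnt t (d.take k) + cnt t (d.drop k) := fun t => by
    rw [← cnt_append, List.take_append_drop]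
  have t2 : ∀ t, cnt t d = cnt t (a.take k) + cnt t (a.drop k) + if t ≤ z then 1 else 0 := fun t => by
    rw [← cnt_append, List.take_append_drop, cnt_perm t h.1, cnt_append, cnt_cons, cnt_nil, zero_add]
  have h5 := h.2 (z + 1) k
  rw [List.take_append_of_le_length (by omega)] at h5
  have s1 := t1 t
  have s2 := t2 t
  have s3 := t1 (z + 1)
  have s4 := t2 (z + 1)
  rw [if_pos ht.2] at s2
  rw [if_neg (by omega)] at s4
  have s5 := cnt_anti (show t ≤ z + 1 by omega) (a.drop k)
  omega

def mxl (l : List ℕ) (z : ℕ) : ℕ := (l.toFinset.filter (· ≤ z)).sup id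

theorem mxl_spec {l : List ℕ} {z : ℕ} (h : ∃ e ∈ l, e ≤ z) :
    mxl l z ∈ l ∧ mxl l z ≤ z ∧ ∀ e ∈ l, e ≤ z → e ≤ mxl l z := by
  have hn : (l.toFinset.filter (· ≤ z)).Nonempty := by
    obtain ⟨e, h1, h2⟩ := h
    exact ⟨e, by simp [h1, h2]⟩
  obtain ⟨x, hx, hx2⟩ := Finset.exists_mem_eq_sup _ hn id
  have : mxl l z = x := hx2
  simp at hx
  refine ⟨this ▸ hx.1, this ▸ hx.2, fun e he hz => ?_⟩
  exact Finset.le_sup (f := id) (b := e) (by simp [he, hz])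

open Classical in
noncomputable def UU : List ℕ → ℕ → List ℕ
  | [], _ => []
  | [_], _ => []
  | x :: (w :: d), z => if x = z ∧ z ∉ (w :: d) then mxl (w :: d) z :: UU (w :: d) (mxl (w :: d) z)
      else x :: UU (w :: d) z

theorem UU_eq (x : ℕ) {d : List ℕ} (hd : d ≠ []) (z : ℕ) : UU (x :: d) z =
    open Classical in if x = z ∧ z ∉ d then mxl d z :: UU d (mxl d z) else x :: UU d z := by
  cases d with
  | nil => exact absurd rfl hd
  | cons w d => rw [UU]

theorem DD_UU (c : List ℕ) : ∀ z, ∀ d ∈ DD c z, c = UU d z := by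
  induction c with
  | nil => intro z d hd; simp [DD] at hd; subst hd; simp [UU]
  | cons x Q ih =>
    intro z d hd
    simp only [DD, List.mem_append, List.mem_map] at hd
    rcases hd with ⟨e, he, rfl⟩ | hd
    · have hz : z ∈ e := (DD_perm _ _ _ he).symm.subset List.mem_cons_self
      rw [UU_eq _ (List.ne_nil_of_mem hz), if_neg (fun h => h.2 hz), ← ih _ _ he]
    · split_ifs at hd with hc
      · obtain ⟨e, he, rfl⟩ := List.mem_map.1 hd
        have hp := DD_perm _ _ _ he
        have hx : x ∈ e := hp.symm.subset List.mem_cons_self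
        have hz : z ∉ e := fun h => by
          rcases List.mem_cons.1 (hp.subset h) with h | h
          · omega
          · exact hc.2 z h ⟨hc.1, le_rfl⟩
        have hm := mxl_spec (l := e) (z := z) ⟨x, hx, hc.1.le⟩
        have hmx : mxl e z = x := by
          have a1 := hm.2.2 x hx hc.1.le
          rcases List.mem_cons.1 (hp.subset hm.1) with h | h
          · exact h
          · have := hc.2 _ h; omega
        rw [UU_eq _ (List.ne_nil_of_mem hx), if_pos ⟨rfl, hz⟩, hmx, ← ih _ _ he]
      · simp at hd

theorem UU_DD (d : List ℕ) : ∀ z, z ∈ d → (∀ h : d ≠ [], d.getLast h ≤ z) → d ∈ DD (UU d z) z := by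
  induction d with
  | nil => intro z h; simp at h
  | cons x d ih =>
    intro z hz hl
    by_cases hd : d = []
    · subst hd; simp at hz; subst hz; simp [UU, DD]
    have hl' : d.getLast hd ≤ z := by have := hl (by simp); rwa [List.getLast_cons hd] at this
    rw [UU_eq _ hd]
    split_ifs with hc
    · have hm := mxl_spec (l := d) (z := z) ⟨_, List.getLast_mem hd, hl'⟩
      have h1 := ih (mxl d z) hm.1 (fun h => hm.2.2 _ (List.getLast_mem hd) hl')
      have hlt : mxl d z < z := by
        rcases hm.2.1.eq_or_lt with h | h
        · exact absurd (h ▸ hm.1) hc.2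
        · exact h
      rw [DD, List.mem_append]; right
      rw [if_pos]
      · rw [hc.1]; exact List.mem_map.2 ⟨d, h1, rfl⟩
      · refine ⟨hlt, fun e he => ?_⟩
        have : e ∈ d := (DD_perm _ _ _ h1).symm.subset (List.mem_cons_of_mem _ he)
        have := hm.2.2 e this
        omega
    · have hzd : z ∈ d := by
        by_contra hn
        rcases List.mem_cons.1 hz with h | h
        · exact hc ⟨h.symm, hn⟩
        · exact hn h
      rw [DD, List.mem_append]; left
      exact List.mem_map.2 ⟨d, ih z hzd (fun h => hl'), rfl⟩

theorem DD_nodup (c : List ℕ) : ∀ z, (DD c z).Nodup := by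
  induction c with
  | nil => intro z; simp [DD]
  | cons x Q ih =>
    intro z
    rw [DD]
    refine List.Nodup.append ((ih z).map (List.cons_injective)) ?_ ?_
    · split_ifs
      · exact ((ih x).map (List.cons_injective))
      · exact List.nodup_nil
    · split_ifs with hc
      · intro e h1 h2
        obtain ⟨_, _, rfl⟩ := List.mem_map.1 h1
        obtain ⟨_, _, h⟩ := List.mem_map.1 h2
        simp at h; omega
      · simp

theorem LSr_nodup (r : List ℕ) : (LSr r).Nodup := by
  induction r with
  | nil => simp [LSr]
  | cons z r ih =>
    rw [LSr, List.nodup_flatMap]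
    refine ⟨fun c _ => DD_nodup _ _, ?_⟩
    refine List.Pairwise.imp ?_ ih
    intro c1 c2 hne d h1 h2
    exact hne ((DD_UU _ _ _ h1).trans (DD_UU _ _ _ h2).symm)

theorem crit_append {a c : List ℕ} (z : ℕ) (h : c ∈ lswapSet a) : c ++ [z] ∈ lswapSet (a ++ [z]) := by
  induction h with
  | refl => exact Relation.ReflTransGen.refl
  | tail _ h ih =>
    obtain ⟨X, u, Y, v, Z, hle, rfl, rfl⟩ := step_decomp h
    refine ih.tail ?_
    have := step_of (X := X) (Y := Y) (Z := Z ++ [z]) hle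
    simpa using this

theorem mem_LSr (r : List ℕ) : ∀ d, d ∈ LSr r ↔ d ∈ lswapSet r.reverse := by
  induction r with
  | nil =>
    intro d
    simp only [LSr, List.mem_singleton, List.reverse_nil, lswap_iff]
    exact ⟨fun h => h ▸ Crit.refl _, fun h => h.1.eq_nil⟩
  | cons z r ih =>
    intro d
    rw [LSr, List.mem_flatMap, List.reverse_cons]
    constructor
    · rintro ⟨c, hc, hd⟩
      exact Relation.ReflTransGen.trans (crit_append z ((ih c).1 hc)) (DD_lswap _ _ _ hd)
    · intro h
      have hcr := lswap_iff.1 h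
      have hz : z ∈ d := hcr.1.symm.subset (by simp)
      have hlast : ∀ h : d ≠ [], d.getLast h ≤ z := by
        intro hne
        by_contra hlt
        push Not at hlt
        have hlen := hcr.1.length_eq
        simp at hlen
        have h1 := hcr.2 (z + 1) r.length
        rw [List.take_append_of_le_length (by simp), List.take_of_length_le (by simp)] at h1
        have h2 : d = d.take r.length ++ [d.getLast hne] := by
          conv_lhs => rw [← List.dropLast_append_getLast hne]
          rw [List.dropLast_eq_take, hlen]; simp
        have h3 := cnt_perm (z + 1) hcr.1
        rw [h2, cnt_append, cnt_append, cnt_cons, cnt_cons, cnt_nil, if_pos (by omega), if_neg (by omega)] at h3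
        omega
      have hd := UU_DD d z hz hlast
      exact ⟨_, (ih _).2 (lswap_iff.2 (DD_crit hd hcr)), hd⟩
end dd

set_option linter.unusedVariables false
set_option linter.unusedSimpArgs false
section quasi
theorem posPt_append (a b : List ℕ) : posPart (a ++ b) = posPart a ++ posPart b := by simp [_root_.posPart]
theorem posPt_sum (a : List ℕ) : (posPart a).sum = a.sum := by
  induction a with
  | nil => rfl
  | cons x a ih =>
    unfold _root_.posPart at *
    rw [List.filter_cons]
    split_ifs with h
    · simp [ih]
    · simp at h; simp [ih, h]
theorem posPt_pos {a : List ℕ} {x : ℕ} (h : x ∈ posPart a) : 0 < x := by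
  simp [_root_.posPart] at h; omega
theorem posPt_take (a : List ℕ) (k : ℕ) : posPart (a.take k) <+: posPart a :=
  (List.take_prefix k a).filter _

theorem pre_of_sum {P Q α : List ℕ} (hP : P <+: α) (hQ : Q <+: α) (h0 : ∀ x ∈ α, 0 < x) (hs : P.sum ≤ Q.sum) :
    P <+: Q := by
  rcases List.prefix_or_prefix_of_prefix hP hQ with h | h
  · exact h
  · obtain ⟨R, rfl⟩ := h
    cases R with
    | nil => simp
    | cons r R =>
      have : 0 < r := h0 r (hP.subset (by simp))
      simp at hs; omega

theorem eq_of_sum {P Q α : List ℕ} (hP : P <+: α) (hQ : Q <+: α) (h0 : ∀ x ∈ α, 0 < x) (hs : P.sum = Q.sum) :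
    P = Q := by
  have h1 := pre_of_sum hP hQ h0 hs.le
  have h2 := pre_of_sum hQ hP h0 hs.ge
  exact h1.eq_of_length (le_antisymm h1.length_le h2.length_le)

theorem cnt_posPart {t : ℕ} (ht : 0 < t) (a : List ℕ) : cnt t (posPart a) = cnt t a := by
  induction a with
  | nil => rfl
  | cons x a ih =>
    unfold _root_.posPart at *
    rw [List.filter_cons]
    split_ifs with h
    · simp [cnt_cons, ih]
    · simp at h; rw [ih, cnt_cons, if_neg (by omega)]; omega
theorem cnt_zero (a : List ℕ) : cnt 0 a = a.length := by unfold cnt; simp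

theorem perm_of_posPart {a b : List ℕ} (hl : a.length = b.length) (h : posPart a = posPart b) : a.Perm b := by
  have key : ∀ a : List ℕ, a.Perm (posPart a ++ List.replicate (a.length - (posPart a).length) 0) := by
    intro a
    have h1 := (List.filter_append_perm (fun v : ℕ => v != 0) a).symm
    have h2 := h1.length_eq
    rw [List.length_append] at h2
    refine h1.trans ?_
    have : a.filter (fun v => !(v != 0)) = List.replicate (a.length - (posPart a).length) 0 := by
      rw [List.eq_replicate_iff]
      constructor
      · unfold _root_.posPart; omega
      · intro b hb; simp at hb; exact hb.2
    rw [this]; exact List.Perm.refl _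
  have h1 := key a
  rw [hl, h] at h1
  exact h1.trans (key b).symm

theorem dom_crit {b c : List ℕ} (h : Dominates c b) (hp : posPart c = posPart b) : Crit b c := by
  refine ⟨perm_of_posPart h.1 hp, fun t k => ?_⟩
  rcases Nat.eq_zero_or_pos t with rfl | ht
  · rw [cnt_zero, cnt_zero, List.length_take, List.length_take, h.1]
  · rw [← cnt_posPart ht, ← cnt_posPart ht (c.take k)]
    have := pre_of_sum (posPt_take b k) (hp ▸ posPt_take c k) (fun x => posPt_pos)
      (by rw [posPt_sum, posPt_sum]; exact h.2 k)
    obtain ⟨R, hR⟩ := this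
    rw [← hR, cnt_append]; omega

theorem meet_case {x' c' α : List ℕ} {u v : ℕ} (h0 : ∀ x ∈ α, 0 < x) (hx : posPart (x' ++ [u]) <+: α)
    (hc : posPart (c' ++ [v]) <+: α) (hlt : c'.sum < x'.sum) (hle : x'.sum + u ≤ c'.sum + v) :
    posPart c' ++ posPart [x'.sum + u - c'.sum] = posPart (x' ++ [u]) := by
  have hv : 0 < v := by omega
  have e : posPart (c' ++ [v]) = posPart c' ++ [v] := by
    rw [posPt_append]; congr 1; simp [_root_.posPart]; omega
  have hx' : posPart x' <+: α := (List.prefix_append _ _).trans (posPt_append x' [u] ▸ hx)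
  have hc' : posPart c' <+: α := (List.prefix_append _ _).trans (posPt_append c' [v] ▸ hc)
  have p1 := pre_of_sum hc' hx' h0 (by rw [posPt_sum, posPt_sum]; omega)
  have l1 : (posPart c').length < (posPart x').length := by
    refine lt_of_le_of_ne p1.length_le fun hl => ?_
    have := p1.eq_of_length hl
    have := congrArg List.sum this
    rw [posPt_sum, posPt_sum] at this; omega
  have p2 : posPart (c' ++ [v]) <+: posPart x' := by
    apply List.prefix_of_prefix_length_le hc hx'
    rw [e]; simp; omega
  have s : (posPart (c' ++ [v])).sum ≤ (posPart x').sum := by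
    obtain ⟨R, hR⟩ := p2
    rw [← hR]; simp
  rw [posPt_sum, posPt_sum] at s
  simp at s
  have hu : u = 0 := by omega
  have hw : x'.sum + u - c'.sum = v := by omega
  rw [hw, ← posPt_append]
  apply eq_of_sum hc hx h0
  rw [posPt_sum, posPt_sum]; simp; omega

theorem take_snoc_eq {x' : List ℕ} {u k : ℕ} (h : x'.length < k) : (x' ++ [u]).take k = x' ++ [u] :=
  List.take_of_length_le (by simp; omega)

theorem meet (α : List ℕ) (h0 : ∀ x ∈ α, 0 < x) (x : List ℕ) : ∀ c : List ℕ, x.length = c.length →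
    posPart x <+: α → posPart c <+: α → ∃ m : List ℕ, m.length = x.length ∧
      (∀ k, (m.take k).sum = min (x.take k).sum (c.take k).sum) ∧
      (x.sum ≤ c.sum → posPart m = posPart x) ∧ (c.sum ≤ x.sum → posPart m = posPart c) := by
  induction x using List.reverseRecOn with
  | nil => intro c hl _ _; simp at hl; symm at hl; simp at hl; subst hl; exact ⟨[], by simp⟩
  | append_singleton x' u ih =>
    intro c hl hx hc
    obtain ⟨c', v, rfl⟩ : ∃ c' v, c = c' ++ [v] := by
      rcases List.eq_nil_or_concat c with h | ⟨c', v, h⟩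
      · subst h; simp at hl
      · exact ⟨c', v, by simpa using h⟩
    have hl' : x'.length = c'.length := by simpa using hl
    have hx' : posPart x' <+: α := (List.prefix_append _ _).trans (posPt_append x' [u] ▸ hx)
    have hc' : posPart c' <+: α := (List.prefix_append _ _).trans (posPt_append c' [v] ▸ hc)
    obtain ⟨m, h1, h2, h3, h4⟩ := ih c' hl' hx' hc'
    have hs : m.sum = min x'.sum c'.sum := by
      have := h2 x'.length
      rwa [List.take_of_length_le (by omega), List.take_of_length_le (by omega), List.take_of_length_le (by omega)] at this
    refine ⟨m ++ [min (x'.sum + u) (c'.sum + v) - min x'.sum c'.sum], by simp [h1], ?_, ?_, ?_⟩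
    · intro k
      by_cases hk : k ≤ x'.length
      · rw [List.take_append_of_le_length (by omega), List.take_append_of_le_length (by omega),
          List.take_append_of_le_length (by omega), h2]
      · rw [take_snoc_eq (by omega), take_snoc_eq (by omega), take_snoc_eq (by omega)]
        simp [hs]
    · intro hle
      simp at hle
      rcases le_or_gt x'.sum c'.sum with h | h
      · rw [posPt_append, posPt_append, h3 h]; congr 2
        rw [min_eq_left hle, min_eq_left h]; simp
      · rw [posPt_append, h4 h.le, min_eq_left hle, min_eq_right h.le]
        exact meet_case h0 hx hc h hle
    · intro hle
      simp at hle
      rcases le_or_gt c'.sum x'.sum with h | h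
      · rw [posPt_append, posPt_append, h4 h]; congr 2
        rw [min_eq_right hle, min_eq_right h]; simp
      · rw [posPt_append, h3 h.le, min_eq_right hle, min_eq_left h.le]
        exact meet_case h0 hc hx h hle

theorem lswap_meet {a x c : List ℕ} (hx : x ∈ lswapSet a) (hc : c ∈ lswapSet a) (hp : posPart c = posPart x) :
    ∃ m ∈ lswapSet a, posPart m = posPart x ∧ ∀ k, (m.take k).sum = min (x.take k).sum (c.take k).sum := by
  rw [lswap_iff] at hx hc
  have hl : x.length = c.length := by rw [hx.1.length_eq, hc.1.length_eq]
  have hsum : x.sum = c.sum := by rw [← posPt_sum, ← hp, posPt_sum]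
  obtain ⟨m, h1, h2, h3, -⟩ := meet (posPart x) (fun _ => posPt_pos) x c hl (List.prefix_refl _)
    (hp ▸ List.prefix_refl _)
  have hmx := h3 hsum.le
  refine ⟨m, lswap_iff.2 ⟨(perm_of_posPart h1 hmx).trans hx.1, fun t k => ?_⟩, hmx, h2⟩
  rcases Nat.eq_zero_or_pos t with rfl | ht
  · rw [cnt_zero, cnt_zero, List.length_take, List.length_take, h1, hx.1.length_eq]
  have h5 := h2 k
  rw [← cnt_posPart ht (m.take k)]
  rcases le_total (x.take k).sum (c.take k).sum with h | h
  · rw [min_eq_left h] at h5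
    rw [eq_of_sum (P := _root_.posPart (m.take k)) (hmx ▸ posPt_take m k) (posPt_take x k) (fun _ => posPt_pos) (by rw [posPt_sum, posPt_sum, h5]),
      cnt_posPart ht]
    exact hx.2 t k
  · rw [min_eq_right h] at h5
    rw [eq_of_sum (P := _root_.posPart (m.take k)) (Q := _root_.posPart (c.take k)) (α := _root_.posPart x) (hmx ▸ posPt_take m k) (hp ▸ posPt_take c k) (fun _ => posPt_pos) (by rw [posPt_sum, posPt_sum, h5]),
      cnt_posPart ht]
    exact hc.2 t k

theorem exists_min {a c : List ℕ} (hc : c ∈ lswapSet a) : ∃ b ∈ QlswapSet a, Dominates c b ∧ posPart c = posPart b := by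
  let T : List ℕ → ℕ := fun x => ∑ k ∈ Finset.range (a.length + 1), (x.take k).sum
  let S : Set (List ℕ) := {x | x ∈ lswapSet a ∧ posPart x = posPart c}
  have hS : S.Nonempty := ⟨c, hc, rfl⟩
  obtain ⟨b, hb, hmin⟩ : ∃ b ∈ S, ∀ x ∈ S, T b ≤ T x := by
    refine ⟨Function.argminOn T S hS, Function.argminOn_mem _ _ _, fun x hx => Function.argminOn_le _ _ hx⟩
  have main : ∀ x ∈ lswapSet a, posPart x = posPart b → Dominates x b := by
    intro x hx hxb
    obtain ⟨m, hm, hmb, hk⟩ := lswap_meet hb.1 hx hxb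
    have hle : T b ≤ T m := hmin m ⟨hm, hmb.trans hb.2⟩
    have lb := (lswap_iff.1 hb.1).1.length_eq
    have lx := (lswap_iff.1 hx).1.length_eq
    refine ⟨by omega, fun k => ?_⟩
    by_cases hk1 : k ≤ a.length
    · by_contra hlt
      push Not at hlt
      have : T m < T b := by
        apply Finset.sum_lt_sum
        · intro i _; rw [hk]; exact min_le_left _ _
        · exact ⟨k, by simp; omega, by rw [hk]; omega⟩
      omega
    · rw [List.take_of_length_le (by omega), List.take_of_length_le (by omega), ← posPt_sum, ← posPt_sum x, hxb]
  exact ⟨b, ⟨hb.1, main⟩, main c hc hb.2.symm, hb.2.symm⟩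

theorem dom_antisymm (b : List ℕ) : ∀ c, Dominates b c → Dominates c b → b = c := by
  intro c h1 h2
  apply List.ext_getElem h1.1
  intro i hi hi'
  have e : ∀ k, (b.take k).sum = (c.take k).sum := fun k => le_antisymm (h2.2 k) (h1.2 k)
  have e1 := e (i + 1)
  rw [List.take_succ_eq_append_getElem hi, List.take_succ_eq_append_getElem hi'] at e1
  have e0 := e i
  rw [List.sum_append, List.sum_append, e0] at e1
  simpa using e1

theorem lswap_finite (a : List ℕ) : (lswapSet a).Finite := by
  apply Set.Finite.subset (List.finite_toSet (LSr a.reverse))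
  intro d hd
  have := (mem_LSr a.reverse d).2 (by simpa using hd)
  exact this

theorem quasi_sum {M : Type*} [AddCommMonoid M] (a : List ℕ) (g : List ℕ → M) :
    ∑ᶠ b ∈ QlswapSet a, ∑ᶠ c ∈ {c : List ℕ | Dominates c b ∧ posPart c = posPart b}, g c =
      ∑ᶠ c ∈ lswapSet a, g c := by
  have hsub : ∀ b ∈ QlswapSet a, {c : List ℕ | Dominates c b ∧ posPart c = posPart b} ⊆ lswapSet a := by
    intro b hb c hc
    exact Relation.ReflTransGen.trans hb.1 (lswap_iff.2 (dom_crit hc.1 hc.2))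
  rw [← finsum_mem_biUnion]
  · congr 1; ext c
    have : (c ∈ ⋃ b ∈ QlswapSet a, {c : List ℕ | Dominates c b ∧ posPart c = posPart b}) ↔ c ∈ lswapSet a := by
      simp only [Set.mem_iUnion]
      constructor
      · rintro ⟨b, hb, hc⟩; exact hsub b hb hc
      · intro hc
        obtain ⟨b, hb, h⟩ := exists_min hc
        exact ⟨b, hb, h⟩
    rw [this]
  · intro b1 hb1 b2 hb2 hne
    rw [Function.onFun, Set.disjoint_left]
    intro c hc1 hc2
    have hp : posPart b1 = posPart b2 := hc1.2.symm.trans hc2.2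
    exact hne (dom_antisymm _ _ (hb2.2 b1 hb1.1 hp) (hb1.2 b2 hb2.1 hp.symm))
  · exact (lswap_finite a).subset (fun b hb => hb.1)
  · intro b hb; exact (lswap_finite a).subset (hsub b hb)
end quasi

set_option linter.unusedVariables false
set_option linter.unusedSimpArgs false
section chains
variable {n : ℕ}

def NCh (A : ℕ → Finset ℕ) (m j : ℕ) (γ σ : Fin n → ℕ) : Set (ℕ → Fin n → ℕ) :=
  {g | g 0 = σ ∧ (∀ k, Valid (j + k) γ (g k)) ∧ (∀ k, Tr γ (g k) (g (k + 1))) ∧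
    (∀ k, k < m → pset (g (k + 1)) = A (j + k + 1)) ∧ ∀ k, m ≤ k → g k = 0}

def gcons (σ : Fin n → ℕ) (g : ℕ → Fin n → ℕ) : ℕ → Fin n → ℕ
  | 0 => σ
  | k + 1 => g k

theorem gcons_inj (σ : Fin n → ℕ) : Function.Injective (gcons σ) := by
  intro g g' h; ext k i; exact congrFun (congrFun h (k + 1)) i

theorem Tr_zero (γ : Fin n → ℕ) : Tr γ 0 0 := by
  refine ⟨fun _ => le_rfl, fun i k _ => ?_⟩
  unfold PC; simp

theorem mem_of_pset {σ : Fin n → ℕ} {A : Finset ℕ} (h : pset σ = A) (i : Fin n) : σ i ∈ insert 0 A := by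
  rw [Finset.mem_insert, ← h]
  by_cases h0 : σ i = 0
  · exact Or.inl h0
  · right; unfold pset; simp [h0]

theorem NCh_zero (A : ℕ → Finset ℕ) (j : ℕ) (γ σ : Fin n → ℕ) :
    NCh A 0 j γ σ = open Classical in if Valid j γ σ ∧ ∀ i, σ i = 0 then {fun _ => 0} else ∅ := by
  ext g
  split_ifs with h
  · rw [Set.mem_singleton_iff]
    have hs : σ = 0 := funext h.2
    constructor
    · rintro ⟨_, _, _, _, h5⟩
      ext k i; rw [h5 k (Nat.zero_le _)]; try rfl
    · rintro rfl
      refine ⟨hs.symm, fun k => ⟨fun i => ?_, fun i k _ h => ?_⟩, fun k => Tr_zero γ, fun k hk => by omega, fun _ _ => rfl⟩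
      · have := h.1.1 i
        rw [h.2 i] at this
        simp at this ⊢; exact (by omega)
      · simp at h
  · simp only [Set.mem_empty_iff_false, iff_false]
    rintro ⟨h1, h2, _, _, h5⟩
    apply h
    refine ⟨by have := h2 0; rwa [h1] at this, fun i => ?_⟩
    rw [← h1, h5 0 le_rfl]; rfl

theorem NCh_succ (A : ℕ → Finset ℕ) (m j : ℕ) (γ σ : Fin n → ℕ) (hV : Valid j γ σ) :
    NCh A (m + 1) j γ σ = ⋃ σ' ∈ {σ' : Fin n → ℕ | σ' ∈ Fintype.piFinset (fun _ : Fin n => insert 0 (A (j + 1))) ∧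
      Tr γ σ σ' ∧ pset σ' = A (j + 1)}, gcons σ '' NCh A m (j + 1) γ σ' := by
  ext g
  simp only [Set.mem_iUnion, Set.mem_image, Set.mem_ofPred_eq]
  constructor
  · rintro ⟨h1, h2, h3, h4, h5⟩
    have hp : pset (g 1) = A (j + 1) := h4 0 (by omega)
    refine ⟨g 1, ⟨?_, h1 ▸ h3 0, hp⟩, fun k => g (k + 1), ?_, ?_⟩
    · rw [Fintype.mem_piFinset]; exact mem_of_pset hp
    · refine ⟨rfl, fun k => ?_, fun k => h3 _, fun k hk => ?_, fun k hk => h5 _ (by omega)⟩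
      · have := h2 (k + 1); rwa [show j + (k + 1) = j + 1 + k by omega] at this
      · have := h4 (k + 1) (by omega); rw [show j + (k + 1) + 1 = j + 1 + k + 1 by omega] at this; exact this
    · ext k i; cases k with
      | zero => rw [← h1]; rfl
      | succ k => rfl
  · rintro ⟨σ', ⟨_, ht, hp⟩, g', ⟨h1, h2, h3, h4, h5⟩, rfl⟩
    refine ⟨rfl, fun k => ?_, fun k => ?_, fun k hk => ?_, fun k hk => ?_⟩
    · cases k with
      | zero => exact hV
      | succ k => have := h2 k; rwa [show j + 1 + k = j + (k + 1) by omega] at this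
    · cases k with
      | zero => show Tr γ σ (g' 0); rw [h1]; exact ht
      | succ k => exact h3 k
    · cases k with
      | zero => show pset (g' 0) = _; rw [h1]; exact hp
      | succ k => have := h4 k (by omega); rw [show j + 1 + k + 1 = j + (k + 1) + 1 by omega] at this; exact this
    · cases k with
      | zero => omega
      | succ k => exact h5 k (by omega)

theorem NN_NCh (A : ℕ → Finset ℕ) (m : ℕ) : ∀ (j : ℕ) (γ σ : Fin n → ℕ), (NCh A m j γ σ).Finite ∧
    NN A m j γ σ = ∑ᶠ g ∈ NCh A m j γ σ, (1 : ℤ) := by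
  classical
  induction m with
  | zero =>
    intro j γ σ
    rw [NCh_zero, NN]
    split_ifs with h
    · exact ⟨Set.finite_singleton _, by rw [finsum_mem_singleton]⟩
    · exact ⟨Set.finite_empty, by rw [finsum_mem_empty]⟩
  | succ m ih =>
    intro j γ σ
    by_cases hV : Valid j γ σ
    · rw [NCh_succ A m j γ σ hV]
      have hI : {σ' : Fin n → ℕ | σ' ∈ Fintype.piFinset (fun _ : Fin n => insert 0 (A (j + 1))) ∧
        Tr γ σ σ' ∧ pset σ' = A (j + 1)}.Finite :=
        (Finset.finite_toSet (Fintype.piFinset (fun _ : Fin n => insert 0 (A (j + 1))))).subset (fun σ' h => h.1)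
      have hfin : ∀ σ', (gcons σ '' NCh A m (j + 1) γ σ').Finite := fun σ' => (ih (j + 1) γ σ').1.image _
      refine ⟨hI.biUnion fun σ' _ => hfin σ', ?_⟩
      rw [finsum_mem_biUnion _ hI (fun σ' _ => hfin σ')]
      · simp only [NN, hV, if_true]
        rw [← Finset.sum_filter]
        have : ∀ σ', ∑ᶠ g ∈ gcons σ '' NCh A m (j + 1) γ σ', (1 : ℤ) = NN A m (j + 1) γ σ' := fun σ' => by
          rw [finsum_mem_image (gcons_inj σ).injOn, ← (ih (j + 1) γ σ').2]
        simp only [this]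
        rw [finsum_mem_eq_finite_toFinset_sum _ hI]
        congr 1
        ext σ'; simp
      · intro s1 _ s2 _ hne
        rw [Function.onFun, Set.disjoint_left]
        rintro _ ⟨g1, h1, rfl⟩ ⟨g2, h2, he⟩
        have := gcons_inj σ he
        subst this
        exact hne (h1.1.symm.trans h2.1)
    · have : NCh A (m + 1) j γ σ = ∅ := by
        ext g; simp only [Set.mem_empty_iff_false, iff_false]
        rintro ⟨h1, h2, _⟩
        exact hV (by have := h2 0; rwa [h1] at this)
      rw [this]
      exact ⟨Set.finite_empty, by rw [finsum_mem_empty]; simp [NN, hV]⟩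

theorem NN_card (A : ℕ → Finset ℕ) (m j : ℕ) (γ σ : Fin n → ℕ) :
    NN A m j γ σ = ((NCh A m j γ σ).ncard : ℤ) := by
  rw [(NN_NCh A m j γ σ).2, finsum_mem_eq_finite_toFinset_sum _ (NN_NCh A m j γ σ).1,
    Set.ncard_eq_toFinset_card _ (NN_NCh A m j γ σ).1]
  simp
end chains

set_option linter.unusedVariables false
set_option linter.unusedSimpArgs false
section fillings
variable {n : ℕ}

def gm (G : ℕ → Fin n → Finset ℕ) (j : ℕ) (i : Fin n) : ℕ := (G j i).sup id
def colC (G : ℕ → Fin n → Finset ℕ) (j : ℕ) : Finset ℕ := Finset.univ.biUnion (G j)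

structure GFill (γ σ0 : Fin n → ℕ) (G : ℕ → Fin n → Finset ℕ) : Prop where
  ne : ∀ j i, (G j i).Nonempty ↔ j ≤ γ i
  base : ∀ i, G 0 i = {σ0 i}
  pos : ∀ j i v, v ∈ G j i → 0 < v
  disj : ∀ j i k, i ≠ k → ∀ v, v ∈ G j i → v ∉ G j k
  row : ∀ j i v, v ∈ G j i → gm G (j + 1) i ≤ v
  pc : ∀ j i k, i < k → PC (gm G j i) (gm G (j + 1) i) (γ i) (gm G j k) (gm G (j + 1) k) (γ k)
  free : ∀ j i v, 1 ≤ j → v ∈ G j i → v ≠ gm G j i → ∀ i', gm G j i' < gm G j i → v < gm G j i' →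
    ¬ gm G (j + 1) i' ≤ v

def Chosen (g g' : Fin n → ℕ) (v : ℕ) (i : Fin n) : Prop :=
  v < g i ∧ g' i ≤ v ∧ ∀ i', v < g i' → g' i' ≤ v → g i ≤ g i'

theorem le_gm {G : ℕ → Fin n → Finset ℕ} {j : ℕ} {i : Fin n} {v : ℕ} (h : v ∈ G j i) : v ≤ gm G j i :=
  Finset.le_sup (f := id) h

theorem gm_mem' {G : ℕ → Fin n → Finset ℕ} {j : ℕ} {i : Fin n} (h : (G j i).Nonempty) : gm G j i ∈ G j i := by
  obtain ⟨v, hv, he⟩ := Finset.exists_mem_eq_sup (G j i) h id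
  unfold gm; rw [he]; exact hv

theorem mem_pset {σ : Fin n → ℕ} {v : ℕ} : v ∈ pset σ ↔ 0 < v ∧ ∃ i, σ i = v := by
  unfold pset; simp [Nat.pos_iff_ne_zero]

namespace GFill
variable {γ σ0 : Fin n → ℕ} {G : ℕ → Fin n → Finset ℕ} (h : GFill γ σ0 G)
theorem gm_pos (h : GFill γ σ0 G) (j : ℕ) (i : Fin n) : 0 < gm G j i ↔ j ≤ γ i := by
  rw [← h.ne]
  constructor
  · intro h0
    by_contra hc
    rw [Finset.not_nonempty_iff_eq_empty] at hc
    unfold gm at h0; rw [hc] at h0; simp at h0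
  · intro hn
    exact h.pos _ _ _ (gm_mem' hn)
theorem gm_mem (h : GFill γ σ0 G) {j : ℕ} {i : Fin n} (hp : 0 < gm G j i) : gm G j i ∈ G j i :=
  gm_mem' ((h.ne j i).2 ((h.gm_pos j i).1 hp))
theorem gm_anti (h : GFill γ σ0 G) (j : ℕ) (i : Fin n) : gm G (j + 1) i ≤ gm G j i := by
  by_cases hp : 0 < gm G (j + 1) i
  · have := (h.gm_pos (j + 1) i).1 hp
    exact h.row _ _ _ (h.gm_mem ((h.gm_pos j i).2 (by omega)))
  · omega
theorem valid (h : GFill γ σ0 G) (j : ℕ) : Valid j γ (gm G j) := by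
  refine ⟨h.gm_pos j, fun i k he hp => ?_⟩
  by_contra hne
  exact h.disj j i k hne _ (h.gm_mem hp) (he ▸ h.gm_mem (he ▸ hp))
theorem tr (h : GFill γ σ0 G) (j : ℕ) : Tr γ (gm G j) (gm G (j + 1)) := ⟨h.gm_anti j, h.pc j⟩
theorem mem_colC {j v : ℕ} : v ∈ colC G j ↔ ∃ i, v ∈ G j i := by unfold colC; simp
theorem chosen (h : GFill γ σ0 G) {j : ℕ} {i : Fin n} {v : ℕ} (hj : 1 ≤ j) (hv : v ∈ G j i) (hne : v ≠ gm G j i) :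
    v ∉ pset (gm G j) ∧ Chosen (gm G j) (gm G (j + 1)) v i := by
  constructor
  · rw [mem_pset]
    rintro ⟨h0, k, hk⟩
    have hk' : v ∈ G j k := by have := h.gm_mem (j := j) (i := k) (by omega); rwa [hk] at this
    by_cases hik : i = k
    · subst hik; exact hne hk.symm
    · exact h.disj j i k hik v hv hk'
  · refine ⟨lt_of_le_of_ne (le_gm hv) hne, h.row _ _ _ hv, fun i' h1 h2 => ?_⟩
    by_contra hc
    exact h.free j i v hj hv hne i' (by omega) h1 h2
theorem key (h : GFill γ σ0 G) {j : ℕ} (i : Fin n) (v : ℕ) (hj : 1 ≤ j) : v ∈ G j i ↔ v ∈ colC G j ∧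
    (v = gm G j i ∨ (v ∉ pset (gm G j) ∧ Chosen (gm G j) (gm G (j + 1)) v i)) := by
  constructor
  · intro hv
    refine ⟨mem_colC.2 ⟨i, hv⟩, ?_⟩
    by_cases hne : v = gm G j i
    · exact Or.inl hne
    · exact Or.inr (h.chosen hj hv hne)
  · rintro ⟨hc, h1⟩
    obtain ⟨k, hk⟩ := mem_colC.1 hc
    have hp := h.pos _ _ _ hk
    rcases h1 with h1 | ⟨h1, h2⟩
    · rw [h1]; exact h.gm_mem (h1 ▸ hp)
    · have hne : v ≠ gm G j k := fun he => h1 (mem_pset.2 ⟨hp, k, he.symm⟩)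
      have h3 := (h.chosen hj hk hne).2
      have : i = k := (h.valid j).2 i k
        (le_antisymm (h2.2.2 k h3.1 h3.2.1) (h3.2.2 i h2.1 h2.2.1)) (by have := h2.1; omega)
      rw [this]; exact hk
end GFill

theorem card_pset {j : ℕ} {γ g : Fin n → ℕ} (hV : Valid j γ g) (v : ℕ) :
    ((pset g).filter (fun u => v < u)).card = (Finset.univ.filter (fun i => v < g i)).card := by
  symm
  apply Finset.card_bij (fun i _ => g i)
  · intro i hi
    simp at hi
    rw [Finset.mem_filter, mem_pset]
    exact ⟨⟨by omega, i, rfl⟩, hi⟩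
  · intro i hi k hk he
    simp at hi
    exact hV.2 i k he (by omega)
  · intro u hu
    rw [Finset.mem_filter, mem_pset] at hu
    obtain ⟨⟨_, i, hi⟩, h2⟩ := hu
    exact ⟨i, by simp [hi, h2], hi⟩

theorem chosen_iff {j j' : ℕ} {γ g g' : Fin n → ℕ} (hV : Valid j γ g) (hV' : Valid j' γ g') (hT : Tr γ g g') (v : ℕ) :
    (∃ i, Chosen g g' v i) ↔ ((pset g).filter (fun u => v < u)).card ≠ ((pset g').filter (fun u => v < u)).card := by
  rw [card_pset hV, card_pset hV']
  have hsub : Finset.univ.filter (fun i => v < g' i) ⊆ Finset.univ.filter (fun i => v < g i) := by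
    intro i hi; simp at hi ⊢; have := hT.1 i; omega
  constructor
  · rintro ⟨i, h1, h2, _⟩ he
    have := Finset.eq_of_subset_of_card_le hsub he.le
    have hi : i ∈ Finset.univ.filter (fun i => v < g i) := by simp [h1]
    rw [← this] at hi; simp at hi; omega
  · intro hne
    have : ∃ i, v < g i ∧ g' i ≤ v := by
      by_contra hc
      push Not at hc
      apply hne
      congr 1
      apply Finset.Subset.antisymm _ hsub
      intro i hi; simp at hi ⊢; exact hc i hi
    obtain ⟨i0, hi0⟩ := this
    obtain ⟨i, hi, hm⟩ := Finset.exists_min_image (Finset.univ.filter (fun i => v < g i ∧ g' i ≤ v)) g ⟨i0, by simp [hi0]⟩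
    simp at hi hm
    exact ⟨i, hi.1, hi.2, hm⟩

def Adm (M : ℕ) (A C : ℕ → Finset ℕ) : Prop :=
  (∀ j, 1 ≤ j → A j ⊆ C j ∧ ∀ v, v ∈ C j → v ∉ A j → 0 < v ∧
    ((A j).filter (fun u => v < u)).card ≠ ((A (j + 1)).filter (fun u => v < u)).card) ∧
  ∀ j, M < j → A j = ∅

def Fib (γ σ0 : Fin n → ℕ) (A C : ℕ → Finset ℕ) : Set (ℕ → Fin n → Finset ℕ) :=
  {G | GFill γ σ0 G ∧ ∀ j, 1 ≤ j → pset (gm G j) = A j ∧ colC G j = C j}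

theorem Fib_adm {M : ℕ} {γ σ0 : Fin n → ℕ} (hM : ∀ i, γ i ≤ M) {A C : ℕ → Finset ℕ} {G : ℕ → Fin n → Finset ℕ}
    (hG : G ∈ Fib γ σ0 A C) : Adm M A C := by
  obtain ⟨h, hd⟩ := hG
  refine ⟨fun j hj => ⟨?_, ?_⟩, ?_⟩
  · rw [← (hd j hj).1, ← (hd j hj).2]
    intro v hv
    rw [mem_pset] at hv
    obtain ⟨h0, i, rfl⟩ := hv
    exact GFill.mem_colC.2 ⟨i, h.gm_mem h0⟩
  · rw [← (hd j hj).1, ← (hd j hj).2, ← (hd (j + 1) (by omega)).1]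
    intro v hv hnv
    obtain ⟨i, hi⟩ := GFill.mem_colC.1 hv
    have h0 := h.pos _ _ _ hi
    refine ⟨h0, (chosen_iff (h.valid j) (h.valid (j + 1)) (h.tr j) v).1 ⟨i, ?_⟩⟩
    exact (h.chosen hj hi (fun he => hnv (mem_pset.2 ⟨h0, i, he.symm⟩))).2
  · intro j hj
    rw [← (hd j (by omega)).1, Finset.eq_empty_iff_forall_notMem]
    intro v hv
    rw [mem_pset] at hv
    obtain ⟨h0, i, rfl⟩ := hv
    have := (h.gm_pos j i).1 h0
    have := hM i; omega

open Classical in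
noncomputable def recG (σ0 : Fin n → ℕ) (A C : ℕ → Finset ℕ) (g : ℕ → Fin n → ℕ) (j : ℕ) (i : Fin n) : Finset ℕ :=
  if j = 0 then {σ0 i} else (C j).filter (fun v => v = g j i ∨ (v ∉ A j ∧ Chosen (g j) (g (j + 1)) v i))

theorem recG_gm {M : ℕ} {γ σ0 : Fin n → ℕ} {A C : ℕ → Finset ℕ} (ha : Adm M A C) {g : ℕ → Fin n → ℕ}
    (hg : g ∈ NCh A (M + 1) 0 γ σ0) (hp : ∀ j, 1 ≤ j → pset (g j) = A j) : gm (recG σ0 A C g) = g := by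
  obtain ⟨h1, h2, h3, h4, h5⟩ := hg
  ext j i
  by_cases hj : j = 0
  · subst hj; simp [gm, recG, h1]
  · have hj1 : 1 ≤ j := by omega
    apply le_antisymm
    · apply Finset.sup_le
      intro v hv
      simp only [recG, hj, if_false, Finset.mem_filter] at hv
      rcases hv.2 with h | ⟨_, h⟩
      · exact h.le
      · exact h.1.le
    · by_cases h0 : 0 < g j i
      · apply le_gm
        simp only [recG, hj, if_false, Finset.mem_filter, true_or, and_true]
        apply (ha.1 j hj1).1
        rw [← hp j hj1, mem_pset]
        exact ⟨h0, i, rfl⟩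
      · omega

theorem Fib_card {M : ℕ} {γ σ0 : Fin n → ℕ} (hM : ∀ i, γ i ≤ M) {A C : ℕ → Finset ℕ} (ha : Adm M A C) :
    Set.BijOn gm (Fib γ σ0 A C) (NCh A (M + 1) 0 γ σ0) := by
  refine ⟨?_, ?_, ?_⟩
  · rintro G ⟨h, hd⟩
    refine ⟨?_, fun k => ?_, h.tr, fun k _ => ?_, fun k hk => ?_⟩
    · ext i; simp [gm, h.base]
    · rw [Nat.zero_add]; exact h.valid k
    · rw [Nat.zero_add]; exact (hd _ (by omega)).1
    · ext i
      have := h.gm_pos k i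
      have := hM i
      show gm G k i = 0
      omega
  · rintro G ⟨h, hd⟩ G' ⟨h', hd'⟩ he
    ext j i v
    by_cases hj : j = 0
    · subst hj; rw [h.base, h'.base]
    · have hj1 : 1 ≤ j := by omega
      rw [h.key i v hj1, h'.key i v hj1, (hd j hj1).2, (hd' j hj1).2, he]
  · intro g hg
    have hp : ∀ j, 1 ≤ j → pset (g j) = A j := by
      intro j hj
      by_cases hjm : j ≤ M + 1
      · have := hg.2.2.2.1 (j - 1) (by omega)
        rwa [Nat.zero_add, show j - 1 + 1 = j by omega] at this
      · rw [ha.2 j (by omega), hg.2.2.2.2 j (by omega)]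
        ext v; simp [mem_pset]; omega
    have hgm := recG_gm ha hg hp
    obtain ⟨h1, h2, h3, h4, h5⟩ := hg
    simp only [Nat.zero_add] at h2
    have hmem : ∀ j, 1 ≤ j → ∀ i v, v ∈ recG σ0 A C g j i ↔ v ∈ C j ∧ (v = g j i ∨ (v ∉ A j ∧ Chosen (g j) (g (j + 1)) v i)) := by
      intro j hj i v
      simp only [recG, show j ≠ 0 by omega, if_false, Finset.mem_filter]
    have hz : ∀ i, recG σ0 A C g 0 i = {σ0 i} := fun i => by simp [recG]
    have hpos : ∀ j i v, v ∈ recG σ0 A C g j i → 0 < v := by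
      intro j i v hv
      by_cases hj : j = 0
      · subst hj; rw [hz, Finset.mem_singleton] at hv
        rw [hv, ← h1]; exact ((h2 0).1 i).2 (Nat.zero_le _)
      · have hj1 : 1 ≤ j := by omega
        rw [hmem j hj1] at hv
        by_cases hA : v ∈ A j
        · rw [← hp j hj1, mem_pset] at hA; exact hA.1
        · exact ((ha.1 j hj1).2 v hv.1 hA).1
    have hgmem : ∀ j, 1 ≤ j → ∀ i, 0 < g j i → g j i ∈ A j := by
      intro j hj i h0
      rw [← hp j hj, mem_pset]; exact ⟨h0, i, rfl⟩
    refine ⟨recG σ0 A C g, ⟨⟨?_, hz, hpos, ?_, ?_, ?_, ?_⟩, ?_⟩, hgm⟩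
    · intro j i
      rw [← (h2 j).1 i]
      constructor
      · rintro ⟨v, hv⟩
        have := hpos _ _ _ hv
        have := le_gm hv
        rw [hgm] at this; omega
      · intro h0
        by_cases hj : j = 0
        · subst hj; rw [hz]; simp
        · have hj1 : 1 ≤ j := by omega
          exact ⟨g j i, (hmem j hj1 i _).2 ⟨(ha.1 j hj1).1 (hgmem j hj1 i h0), Or.inl rfl⟩⟩
    · intro j i k hik v hv hv'
      have h0 := hpos _ _ _ hv
      apply hik
      by_cases hj : j = 0
      · subst hj; rw [hz, Finset.mem_singleton, ← h1] at hv hv'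
        exact (h2 0).2 i k (hv.symm.trans hv') (by omega)
      · have hj1 : 1 ≤ j := by omega
        rw [hmem j hj1] at hv hv'
        rcases hv.2 with h | ⟨hA, h⟩
        · rcases hv'.2 with h' | ⟨hA', h'⟩
          · exact (h2 j).2 i k (h.symm.trans h') (by omega)
          · exact absurd (h ▸ hgmem j hj1 i (by omega)) hA'
        · rcases hv'.2 with h' | ⟨hA', h'⟩
          · exact absurd (h' ▸ hgmem j hj1 k (by omega)) hA
          · exact (h2 j).2 i k (le_antisymm (h.2.2 k h'.1 h'.2.1) (h'.2.2 i h.1 h.2.1)) (by have := h.1; omega)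
    · intro j i v hv
      rw [hgm]
      by_cases hj : j = 0
      · subst hj; rw [hz, Finset.mem_singleton, ← h1] at hv
        rw [hv]; exact (h3 0).1 i
      · rw [hmem j (by omega)] at hv
        rcases hv.2 with h | ⟨_, h⟩
        · rw [h]; exact (h3 j).1 i
        · exact h.2.1
    · intro j i k hik
      rw [hgm]; exact (h3 j).2 i k hik
    · intro j i v hj hv hne i' hlt hv' hle
      rw [hgm] at *
      rw [hmem j hj] at hv
      rcases hv.2 with h | ⟨_, h⟩
      · exact hne h
      · have := h.2.2 i' hv' hle; omega
    · intro j hj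
      rw [hgm]
      refine ⟨hp j hj, ?_⟩
      ext v
      rw [GFill.mem_colC]
      constructor
      · rintro ⟨i, hi⟩; exact ((hmem j hj i v).1 hi).1
      · intro hv
        by_cases hA : v ∈ A j
        · have hA' := hA
          rw [← hp j hj, mem_pset] at hA'
          obtain ⟨_, i, hi⟩ := hA'
          exact ⟨i, (hmem j hj i v).2 ⟨hv, Or.inl hi.symm⟩⟩
        · have hne := ((ha.1 j hj).2 v hv hA).2
          rw [← hp j hj, ← hp (j + 1) (by omega)] at hne
          obtain ⟨i, hi⟩ := (chosen_iff (h2 j) (h2 (j + 1)) (h3 j) v).2 hne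
          exact ⟨i, (hmem j hj i v).2 ⟨hv, Or.inr ⟨hA, hi⟩⟩⟩

open Classical in
theorem Fib_ncard {M : ℕ} {γ σ0 : Fin n → ℕ} (hM : ∀ i, γ i ≤ M) (A C : ℕ → Finset ℕ) :
    ((Fib γ σ0 A C).ncard : ℤ) = if Adm M A C then NN A (M + 1) 0 γ σ0 else 0 := by
  split_ifs with h
  · rw [NN_card, ← (Fib_card hM h).image_eq, Set.InjOn.ncard_image (Fib_card hM h).injOn]
  · have : Fib γ σ0 A C = ∅ := by
      rw [Set.eq_empty_iff_forall_notMem]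
      intro G hG; exact h (Fib_adm hM hG)
    rw [this]; simp
end fillings

set_option linter.unusedVariables false
set_option linter.unusedSimpArgs false
section sums
variable {n : ℕ}

def dat (G : ℕ → Fin n → Finset ℕ) : (ℕ → Finset ℕ) × (ℕ → Finset ℕ) :=
  (fun j => pset (gm G (j + 1)), fun j => colC G (j + 1))

theorem Fib_dat (γ σ0 : Fin n → ℕ) (D : (ℕ → Finset ℕ) × (ℕ → Finset ℕ)) :
    Fib γ σ0 (fun j => D.1 (j - 1)) (fun j => D.2 (j - 1)) = {G | GFill γ σ0 G ∧ dat G = D} := by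
  ext G
  unfold Fib
  simp only [Set.mem_ofPred_eq]
  refine and_congr_right fun _ => ⟨fun h => ?_, ?_⟩
  · apply Prod.ext
    · ext1 j; exact (h (j + 1) (by omega)).1
    · ext1 j; exact (h (j + 1) (by omega)).2
  · rintro rfl j hj
    obtain ⟨j, rfl⟩ : ∃ k, j = k + 1 := ⟨j - 1, by omega⟩
    exact ⟨rfl, rfl⟩

theorem GFill.gm_le_base {γ σ0 : Fin n → ℕ} {G : ℕ → Fin n → Finset ℕ} (h : GFill γ σ0 G) (j : ℕ) (i : Fin n) :
    gm G j i ≤ σ0 i := by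
  induction j with
  | zero => simp [gm, h.base]
  | succ j ih => exact (h.gm_anti j i).trans ih

theorem GFill_finite {M : ℕ} {γ σ0 : Fin n → ℕ} (hM : ∀ i, γ i ≤ M) :
    {G | GFill γ σ0 G}.Finite := by
  let t : Finset (Fin (M + 1) → Fin n → Finset ℕ) :=
    Fintype.piFinset fun _ => Fintype.piFinset fun i => (Finset.range (σ0 i + 1)).powerset
  refine Set.Finite.of_injOn (f := fun G => fun (j : Fin (M + 1)) i => G j i) (t := (t : Set _)) ?_ ?_ t.finite_toSet
  · intro G hG
    simp only [t, Finset.mem_coe, Fintype.mem_piFinset, Finset.mem_powerset]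
    intro j i v hv
    rw [Finset.mem_range]
    have := le_gm hv
    have := GFill.gm_le_base hG j i
    omega
  · intro G hG G' hG' he
    ext1 j; ext1 i
    by_cases hj : j < M + 1
    · exact congrFun (congrFun he ⟨j, hj⟩) i
    · have e : ∀ G, GFill γ σ0 G → G j i = ∅ := by
        intro G hG
        by_contra hc
        rw [← ne_eq, ← Finset.nonempty_iff_ne_empty, hG.ne] at hc
        have := hM i; omega
      rw [e G hG, e G' hG']

theorem fill_sum {R : Type*} [AddCommGroup R] {M : ℕ} {γ σ0 : Fin n → ℕ} (hM : ∀ i, γ i ≤ M)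
    (w : (ℕ → Finset ℕ) × (ℕ → Finset ℕ) → R) (T : Finset ((ℕ → Finset ℕ) × (ℕ → Finset ℕ)))
    (hT : ∀ G, GFill γ σ0 G → dat G ∈ T) :
    ∑ᶠ G ∈ {G | GFill γ σ0 G}, w (dat G) = ∑ D ∈ T,
      ((Fib γ σ0 (fun j => D.1 (j - 1)) (fun j => D.2 (j - 1))).ncard : ℤ) • w D := by
  classical
  have hf := GFill_finite (σ0 := σ0) hM
  rw [finsum_mem_eq_finite_toFinset_sum _ hf,
    ← Finset.sum_fiberwise_of_maps_to (t := T) (g := dat) (fun G hG => hT G (by simpa using hG))]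
  refine Finset.sum_congr rfl fun D _ => ?_
  rw [Finset.sum_congr rfl (g := fun _ => w D) (fun G hG => by rw [(Finset.mem_filter.1 hG).2]),
    Finset.sum_const, natCast_zsmul, Fib_dat, ← Set.ncard_coe_finset]
  congr 2
  ext G; simp

theorem fill_main {R ι : Type*} [AddCommGroup R] {M : ℕ} (s : Finset ι) (γ σ : ι → Fin n → ℕ) (γ' σ' : Fin n → ℕ)
    (hM : ∀ c ∈ s, ∀ i, γ c i ≤ M) (hM' : ∀ i, γ' i ≤ M)
    (hN : ∀ A m, NN A m 0 γ' σ' = ∑ c ∈ s, NN A m 0 (γ c) (σ c))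
    (w : (ℕ → Finset ℕ) × (ℕ → Finset ℕ) → R) :
    ∑ᶠ G ∈ {G | GFill γ' σ' G}, w (dat G) = ∑ c ∈ s, ∑ᶠ G ∈ {G | GFill (γ c) (σ c) G}, w (dat G) := by
  classical
  have hf' := GFill_finite (σ0 := σ') hM'
  have hU : (⋃ c ∈ s, {G | GFill (γ c) (σ c) G}).Finite :=
    s.finite_toSet.biUnion fun c hc => GFill_finite (hM c hc)
  let T := (hf'.toFinset ∪ hU.toFinset).image dat
  rw [fill_sum hM' w T (fun G hG => Finset.mem_image_of_mem _ (by simp [hG]))]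
  rw [Finset.sum_congr rfl (fun c hc => fill_sum (hM c hc) w T (fun G hG => Finset.mem_image_of_mem _
    (Finset.mem_union_right _ (by rw [Set.Finite.mem_toFinset]; exact Set.mem_biUnion (by exact_mod_cast hc) hG))))]
  rw [Finset.sum_comm]
  refine Finset.sum_congr rfl fun D _ => ?_
  rw [← Finset.sum_smul, Fib_ncard hM', Finset.sum_congr rfl (fun c hc => Fib_ncard (hM c hc) _ _)]
  split_ifs with h
  · rw [hN]
  · simp

noncomputable def Wt (M : ℕ) (D : (ℕ → Finset ℕ) × (ℕ → Finset ℕ)) : MvPolynomial ℕ (Polynomial ℤ) :=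
  MvPolynomial.C (Polynomial.X ^ ((∑ j ∈ Finset.range M, (D.2 j).card) - M)) *
    vmono (fun v => ∑ j ∈ Finset.range M, if v ∈ D.2 j then 1 else 0)

def gA (b : List ℕ) : Fin b.length → ℕ := fun i => b.getD i 0

def toF (b : List ℕ) (G : ℕ → Fin b.length → Finset ℕ) : SVF := fun i j =>
  if h : 1 ≤ i ∧ i ≤ b.length then G j ⟨i - 1, by omega⟩ else ∅

theorem skyline_sum (b : List ℕ) (h : ℕ × ℕ → ℕ) :
    ∑ p ∈ skyline b, h p = ∑ i ∈ Finset.range b.length, ∑ j ∈ Finset.range (b.getD i 0), h (i + 1, j + 1) := by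
  unfold skyline
  rw [Finset.sum_biUnion]
  · refine Finset.sum_congr rfl fun i _ => ?_
    rw [Finset.sum_image]
    intro x _ y _ hxy; simpa using hxy
  · intro i _ k _ hik
    rw [Function.onFun, Finset.disjoint_left]
    intro p hp hp'
    simp only [Finset.mem_image] at hp hp'
    obtain ⟨_, _, rfl⟩ := hp
    obtain ⟨_, _, he⟩ := hp'
    simp at he; exact hik he.1.symm

theorem getD_le_sum (b : List ℕ) (i : ℕ) : b.getD i 0 ≤ b.sum := by
  by_cases hi : i < b.length
  · rw [List.getD_eq_getElem _ _ hi]; exact List.le_sum_of_mem (List.getElem_mem hi)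
  · rw [List.getD_eq_default _ _ (by omega)]; omega

theorem skyline_sum' (b : List ℕ) (h : ℕ × ℕ → ℕ) (hz : ∀ i j, b.getD i 0 ≤ j → h (i + 1, j + 1) = 0) :
    ∑ p ∈ skyline b, h p = ∑ j ∈ Finset.range b.sum, ∑ i : Fin b.length, h (i + 1, j + 1) := by
  rw [skyline_sum, Finset.sum_comm, ← Fin.sum_univ_eq_sum_range (fun i => ∑ j ∈ Finset.range (b.getD i 0), h (i + 1, j + 1))]
  refine Finset.sum_congr rfl fun i _ => ?_
  apply Finset.sum_subset
  · intro j hj; rw [Finset.mem_range] at *; exact hj.trans_le (getD_le_sum b i)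
  · intro j _ hj; exact hz i j (by rw [Finset.mem_range] at hj; omega)

theorem wt_toF {b : List ℕ} {σ0 : Fin b.length → ℕ} {G : ℕ → Fin b.length → Finset ℕ} (hG : GFill (gA b) σ0 G)
    {F : SVF} (hF : ∀ i : Fin b.length, ∀ j, F (i + 1) (j + 1) = G (j + 1) i)  :
    MvPolynomial.C (Polynomial.X ^ (sizeF b F - b.sum)) * vmono (wtF b F) = Wt b.sum (dat G) := by
  have hz : ∀ i j, b.getD i 0 ≤ j → i < b.length → F (i + 1) (j + 1) = ∅ := by
    intro i j hij hi
    rw [hF ⟨i, hi⟩ j]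
    by_contra hc
    rw [← ne_eq, ← Finset.nonempty_iff_ne_empty, hG.ne] at hc
    unfold gA at hc; simp only at hc; omega
  have h1 : sizeF b F = ∑ j ∈ Finset.range b.sum, ((dat G).2 j).card := by
    unfold sizeF
    have := skyline_sum' b (fun p => if p.1 - 1 < b.length then (F p.1 p.2).card else 0) (fun i j hij => by
      simp only; split_ifs with h
      · rw [hz i j hij (by simpa using h)]; rfl
      · rfl)
    rw [Finset.sum_congr rfl (g := fun p : ℕ × ℕ => if p.1 - 1 < b.length then (F p.1 p.2).card else 0), this]
    · refine Finset.sum_congr rfl fun j _ => ?_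
      unfold dat colC
      rw [Finset.card_biUnion]
      · refine Finset.sum_congr rfl fun i _ => ?_
        simp [hF]
      · intro i _ k _ hik
        rw [Function.onFun, Finset.disjoint_left]; exact hG.disj _ i k hik
    · intro p hp
      unfold skyline at hp
      simp at hp
      obtain ⟨i, hi, j, hj, rfl⟩ := hp
      simp [hi]
  have h2 : wtF b F = fun v => ∑ j ∈ Finset.range b.sum, if v ∈ (dat G).2 j then 1 else 0 := by
    ext v
    unfold wtF
    rw [Finset.card_filter]
    have := skyline_sum' b (fun p => if p.1 - 1 < b.length then (if v ∈ F p.1 p.2 then 1 else 0) else 0) (fun i j hij => by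
      simp only; split_ifs with h h'
      · rw [hz i j hij (by simpa using h)] at h'; simp at h'
      · rfl
      · rfl)
    rw [Finset.sum_congr rfl (g := fun p : ℕ × ℕ => if p.1 - 1 < b.length then (if v ∈ F p.1 p.2 then 1 else 0) else 0), this]
    · refine Finset.sum_congr rfl fun j _ => ?_
      simp only [Nat.add_sub_cancel, Fin.is_lt, if_true, hF]
      unfold dat
      simp only [GFill.mem_colC]
      split_ifs with h
      · obtain ⟨i, hi⟩ := h
        rw [Finset.sum_eq_single i]
        · simp [hi]
        · intro k _ hk
          rw [if_neg (hG.disj _ i k (Ne.symm hk) v hi)]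
        · simp
      · apply Finset.sum_eq_zero
        intro i _; rw [if_neg]; exact fun hc => h ⟨i, hc⟩
    · intro p hp
      unfold skyline at hp
      simp at hp
      obtain ⟨i, hi, j, hj, rfl⟩ := hp
      simp [hi]
  unfold Wt
  rw [h1, h2]
end sums

set_option linter.unusedVariables false
set_option linter.unusedSimpArgs false
section bij

def frF (b : List ℕ) (F : SVF) : ℕ → Fin b.length → Finset ℕ := fun j k => F (k + 1) j
def SuppF (b : List ℕ) (F : SVF) : Prop := ∀ i j : ℕ, (¬ ∃ k : Fin b.length, i = k.val + 1) → F i j = ∅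

theorem le_infv {F : SVF} {i j x : ℕ} (h : (F i j).Nonempty) : x ≤ infv F i j ↔ ∀ v ∈ F i j, x ≤ v := by
  unfold infv
  constructor
  · intro hx v hv
    exact hx.trans (Nat.sInf_le (by exact_mod_cast hv))
  · intro hx
    exact hx _ (by exact_mod_cast Nat.sInf_mem (s := (F i j : Set ℕ)) (by exact_mod_cast h))

theorem SBox_iff (b : List ℕ) (i j : ℕ) : SBox b i j ↔ 1 ≤ j ∧ ∃ k : Fin b.length, i = k + 1 ∧ j ≤ gA b k := by
  unfold SBox shapeLen gA
  constructor
  · rintro ⟨h1, h2, h3, h4⟩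
    exact ⟨h3, ⟨i - 1, by omega⟩, by simp only; omega, h4⟩
  · rintro ⟨h3, k, rfl, h4⟩
    exact ⟨by omega, by omega, h3, by simpa using h4⟩

theorem BBox_iff (a : List ℕ) (i j : ℕ) : BBox a i j ↔ ∃ k : Fin a.reverse.length, i = k + 1 ∧ j ≤ gA a.reverse k := by
  unfold BBox
  rw [SBox_iff]
  constructor
  · rintro (⟨h1, h2, rfl⟩ | ⟨_, h⟩)
    · exact ⟨⟨i - 1, by rw [List.length_reverse]; omega⟩, by simp only; omega, Nat.zero_le _⟩
    · exact h
  · rintro ⟨k, hk, hj⟩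
    by_cases h : j = 0
    · left; have hk2 := k.2; have := List.length_reverse (as := a); omega
    · right; exact ⟨by omega, k, hk, hj⟩

theorem SBox_succ (b : List ℕ) (k : Fin b.length) (j : ℕ) : SBox b (k + 1) j ↔ 1 ≤ j ∧ j ≤ gA b k := by
  rw [SBox_iff]
  refine and_congr_right fun _ => ⟨?_, fun h => ⟨k, rfl, h⟩⟩
  rintro ⟨l, h, h'⟩
  have : k = l := Fin.ext (by omega)
  rwa [this]

theorem BBox_succ (a : List ℕ) (k : Fin a.reverse.length) (j : ℕ) : BBox a (k + 1) j ↔ j ≤ gA a.reverse k := by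
  rw [BBox_iff]
  refine ⟨?_, fun h => ⟨k, rfl, h⟩⟩
  rintro ⟨l, h, h'⟩
  have : k = l := Fin.ext (by omega)
  rwa [this]

theorem shapeLen_succ (b : List ℕ) (k : Fin b.length) : shapeLen b (k + 1) = gA b k := by
  simp [shapeLen, gA]

theorem anc_zero {F : SVF} {i j : ℕ} (h : ¬ (F i j).Nonempty) : anc F i j = 0 := by
  rw [Finset.not_nonempty_iff_eq_empty] at h
  simp [anc, h]

theorem anc_mem {F : SVF} {i j : ℕ} (h : (F i j).Nonempty) : anc F i j ∈ F i j := by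
  obtain ⟨v, hv, he⟩ := Finset.exists_mem_eq_sup (F i j) h id
  unfold anc; rw [he]; exact hv

theorem LSSF_iff (a : List ℕ) (F : SVF) : LSSF a F ↔
    GFill (gA a.reverse) (fun i => a.reverse.length - i) (frF a.reverse F) ∧ SuppF a.reverse F := by
  have hgm : ∀ j k, gm (frF a.reverse F) j k = anc F (k + 1) j := fun j k => rfl
  constructor
  · rintro ⟨h1, h2, h3, h4, h5, h6, h7, h8⟩
    have hne : ∀ j (k : Fin a.reverse.length), (F (k + 1) j).Nonempty ↔ j ≤ gA a.reverse k := fun j k => by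
      rw [h1, BBox_succ]
    have hz : ∀ j (k : Fin a.reverse.length), anc F (k + 1) j ≠ 0 → j ≤ gA a.reverse k := by
      intro j k h
      by_contra hc
      rw [← hne] at hc
      exact h (anc_zero hc)
    refine ⟨⟨hne, ?_, ?_, ?_, ?_, ?_, ?_⟩, ?_⟩
    · intro k
      have hk2 := k.2
      have hlr := List.length_reverse (as := a)
      show F (k + 1) 0 = _
      rw [h2 _ (by omega) (by omega)]
      congr 1; omega
    · intro j k v hv; exact h3 _ _ _ hv
    · intro j i k hik v hv
      exact h4 j (i + 1) (k + 1) (by intro h; exact hik (Fin.ext (by omega))) v hv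
    · intro j k v hv
      rw [hgm]
      by_cases h : anc F (k + 1) (j + 1) = 0
      · omega
      · have hk := hz _ _ h
        exact (le_infv ((hne j k).2 (by omega))).1 (h5 _ _ ((BBox_succ a k j).2 (by omega)) ((BBox_succ a k (j + 1)).2 hk)) v hv
    · intro j i k hik
      have hik' : (i : ℕ) + 1 < k + 1 := by rw [Fin.lt_def] at hik; omega
      simp only [hgm]
      constructor
      · rintro hl ⟨p1, p2⟩
        have hk := hz _ _ (show anc F (k + 1) (j + 1) ≠ 0 by omega)
        have := h6 _ _ j hik' ((BBox_succ _ _ _).2 (by omega)) ((BBox_succ _ _ _).2 (by omega)) ((BBox_succ _ _ _).2 (by omega))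
          (by rw [shapeLen_succ, shapeLen_succ]; exact hl)
        unfold InvTriple at this; omega
      · rintro hl ⟨p0, p1, p2⟩
        have hi := hz j i (by omega)
        have := h7 _ _ j hik' ((BBox_succ _ _ _).2 (by omega)) ((BBox_succ _ _ _).2 (by omega)) ((BBox_succ _ _ _).2 (by omega))
          (by rw [shapeLen_succ, shapeLen_succ]; exact hl)
        unfold InvTriple at this; omega
    · intro j i v hj hv hvn i' hlt hvl hle
      simp only [hgm] at *
      have hi' := hz j i' (by omega)
      refine h8 (i + 1) j v ((h1 _ _).1 ⟨v, hv⟩) hj hv hvn (i' + 1) ((BBox_succ _ _ _).2 hi') hlt hvl ⟨?_, Or.inr hle⟩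
      have := h5 (i' + 1) (j - 1) ((BBox_succ _ _ _).2 (by omega)) (by rw [Nat.sub_add_cancel hj]; exact (BBox_succ _ _ _).2 hi')
      rw [Nat.sub_add_cancel hj] at this
      omega
    · intro i j hi
      by_contra hc
      rw [← ne_eq, ← Finset.nonempty_iff_ne_empty, h1, BBox_iff] at hc
      obtain ⟨k, hk, _⟩ := hc
      exact hi ⟨k, hk⟩
  · rintro ⟨h, hS⟩
    have hsupp : ∀ i j, (F i j).Nonempty → ∃ k : Fin a.reverse.length, i = k + 1 := by
      intro i j hn
      by_contra hc
      rw [hS i j hc] at hn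
      simp at hn
    have hpos := h.gm_pos
    have hanti := h.gm_anti
    simp only [hgm] at hpos hanti
    refine ⟨?_, ?_, ?_, ?_, ?_, ?_, ?_, ?_⟩
    · intro i j
      rw [BBox_iff]
      constructor
      · intro hn
        obtain ⟨k, rfl⟩ := hsupp _ _ hn
        exact ⟨k, rfl, (h.ne j k).1 hn⟩
      · rintro ⟨k, rfl, hj⟩
        exact (h.ne j k).2 hj
    · intro i hi1 hi2
      have := h.base ⟨i - 1, by rw [List.length_reverse]; omega⟩
      unfold frF at this
      simp only [Nat.sub_add_cancel hi1] at this
      rw [this, List.length_reverse]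
      congr 1; omega
    · intro i j v hv
      obtain ⟨k, rfl⟩ := hsupp _ _ ⟨v, hv⟩
      exact h.pos j k v hv
    · intro j i i' hii v hv hv'
      obtain ⟨k, rfl⟩ := hsupp _ _ ⟨v, hv⟩
      obtain ⟨k', rfl⟩ := hsupp _ _ ⟨v, hv'⟩
      exact h.disj j k k' (by rintro rfl; exact hii rfl) v hv hv'
    · intro i j b1 b2
      rw [BBox_iff] at b1
      obtain ⟨k, rfl, hk⟩ := b1
      rw [le_infv ((h.ne j k).2 hk)]
      exact fun v hv => h.row j k v hv
    · intro i i' j hii b1 b2 b3 hl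
      rw [BBox_iff] at b1 b3
      obtain ⟨k, rfl, hk⟩ := b1
      obtain ⟨k', rfl, hk'⟩ := b3
      rw [shapeLen_succ, shapeLen_succ] at hl
      have p := (h.pc j k k' (by rw [Fin.lt_def]; omega)).1 hl
      simp only [hgm] at p
      have q : anc F (k + 1) (j + 1) ≠ anc F (k' + 1) (j + 1) := fun he => by
        have := (h.valid (j + 1)).2 k k' he ((h.gm_pos _ _).2 (by omega))
        subst this; omega
      have := hanti j k
      unfold InvTriple; omega
    · intro i i' j hii b1 b2 b3 hl
      rw [BBox_iff] at b1 b3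
      obtain ⟨k', rfl, hk'⟩ := b1
      obtain ⟨k, rfl, hk⟩ := b3
      rw [shapeLen_succ, shapeLen_succ] at hl
      have p := (h.pc j k k' (by rw [Fin.lt_def]; omega)).2 hl
      simp only [hgm] at p
      have := hanti j k'
      have := (hpos j k).2 hk
      unfold InvTriple; omega
    · intro i j v b1 hj hv hvn i' b2 hlt hvl hR
      rw [BBox_iff] at b1 b2
      obtain ⟨k, rfl, hk⟩ := b1
      obtain ⟨k', rfl, hk'⟩ := b2
      refine h.free j k v hj hv hvn k' hlt hvl ?_
      rw [hgm]
      rcases hR.2 with h' | h'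
      · rw [BBox_succ] at h'
        have := hpos (j + 1) k'
        omega
      · exact h'

def frL (b : List ℕ) (F : SVF) : ℕ → Fin b.length → Finset ℕ := fun j k => if j = 0 then {k.val + 1} else F (k + 1) j

theorem LASSF_iff (b : List ℕ) (F : SVF) : LASSF b F ↔
    GFill (gA b) (fun i => i.val + 1) (frL b F) ∧ SuppF b F ∧ ∀ i, F i 0 = ∅ := by
  have hgm : ∀ j k, gm (frL b F) (j + 1) k = anc F (k + 1) (j + 1) := fun j k => rfl
  have hgm0 : ∀ k, gm (frL b F) 0 k = k + 1 := fun k => by simp [gm, frL]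
  have hfr : ∀ j k, frL b F (j + 1) k = F (k + 1) (j + 1) := fun j k => rfl
  constructor
  · rintro ⟨⟨h1, h3, h4, h5, h6, h7, h8⟩, h9⟩
    have hne : ∀ j (k : Fin b.length), (F (k + 1) (j + 1)).Nonempty ↔ j + 1 ≤ gA b k := fun j k => by
      rw [h1, SBox_succ]; omega
    have hz : ∀ j (k : Fin b.length), anc F (k + 1) (j + 1) ≠ 0 → j + 1 ≤ gA b k := by
      intro j k h
      by_contra hc
      rw [← hne] at hc
      exact h (anc_zero hc)
    have h10 : ∀ k : Fin b.length, anc F (k + 1) 1 = if 1 ≤ gA b k then k.val + 1 else 0 := by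
      intro k
      split_ifs with h
      · exact h9 _ ((SBox_succ _ _ _).2 ⟨le_rfl, h⟩)
      · by_contra hc; exact h (hz 0 k hc)
    have bs : ∀ j (k : Fin b.length), SBox b (k + 1) (j + 1) ↔ j + 1 ≤ gA b k := fun j k => by
      rw [SBox_succ]; omega
    refine ⟨⟨?_, ?_, ?_, ?_, ?_, ?_, ?_⟩, ?_, ?_⟩
    · intro j k
      cases j with
      | zero => simp [frL]
      | succ j => exact hne j k
    · intro k; simp [frL]
    · intro j k v hv
      cases j with
      | zero => simp [frL] at hv; omega
      | succ j => exact h3 _ _ _ hv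
    · intro j i k hik v hv
      cases j with
      | zero =>
        simp [frL] at hv ⊢
        have : (i : ℕ) ≠ k := fun h => hik (Fin.ext h)
        omega
      | succ j => exact h4 (j + 1) (i + 1) (k + 1) (by intro h; exact hik (Fin.ext (by omega))) v hv
    · intro j k v hv
      rw [hgm]
      cases j with
      | zero =>
        simp [frL] at hv
        rw [h10]; split_ifs <;> omega
      | succ j =>
        by_cases h : anc F (k + 1) (j + 1 + 1) = 0
        · omega
        · have hk := hz _ _ h
          exact (le_infv ((hne j k).2 (by omega))).1 (h5 _ _ ((bs j k).2 (by omega)) ((bs (j + 1) k).2 hk)) v hv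
    · intro j i k hik
      have hik' : (i : ℕ) + 1 < k + 1 := by rw [Fin.lt_def] at hik; omega
      cases j with
      | zero =>
        simp only [hgm, hgm0, h10]
        unfold PC
        split_ifs <;> omega
      | succ j =>
        simp only [hgm]
        constructor
        · rintro hl ⟨p1, p2⟩
          have hk := hz _ _ (show anc F (k + 1) (j + 1 + 1) ≠ 0 by omega)
          have := h6 _ _ (j + 1) hik' ((bs _ _).2 (by omega)) ((bs _ _).2 (by omega)) ((bs _ _).2 (by omega))
            (by rw [shapeLen_succ, shapeLen_succ]; exact hl)
          unfold InvTriple at this; omega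
        · rintro hl ⟨p0, p1, p2⟩
          have hi := hz j i (by omega)
          have := h7 _ _ (j + 1) hik' ((bs _ _).2 (by omega)) ((bs _ _).2 (by omega)) ((bs _ _).2 (by omega))
            (by rw [shapeLen_succ, shapeLen_succ]; exact hl)
          unfold InvTriple at this; omega
    · intro j i v hj hv hvn i' hlt hvl hle
      obtain ⟨j, rfl⟩ : ∃ l, j = l + 1 := ⟨j - 1, by omega⟩
      simp only [hgm, hfr] at *
      have hi' := hz j i' (by omega)
      refine h8 (i + 1) (j + 1) v ((h1 _ _).1 ⟨v, hv⟩) hv hvn (i' + 1) ((bs _ _).2 hi') hlt hvl ⟨?_, Or.inr hle⟩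
      by_cases hj0 : j = 0
      · left; omega
      · right
        obtain ⟨j, rfl⟩ : ∃ l, j = l + 1 := ⟨j - 1, by omega⟩
        have := h5 (i' + 1) (j + 1) ((bs _ _).2 (by omega)) ((bs _ _).2 hi')
        simp only [Nat.add_sub_cancel]
        omega
    · intro i j hi
      by_contra hc
      rw [← ne_eq, ← Finset.nonempty_iff_ne_empty, h1, SBox_iff] at hc
      obtain ⟨_, k, hk, _⟩ := hc
      exact hi ⟨k, hk⟩
    · intro i
      by_contra hc
      rw [← ne_eq, ← Finset.nonempty_iff_ne_empty, h1, SBox_iff] at hc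
      omega
  · rintro ⟨h, hS, h0⟩
    have hsupp : ∀ i j, (F i j).Nonempty → ∃ l, ∃ k : Fin b.length, i = k + 1 ∧ j = l + 1 := by
      intro i j hn
      cases j with
      | zero => rw [h0] at hn; simp at hn
      | succ l =>
        refine ⟨l, ?_⟩
        by_contra hc
        rw [hS i _ (by simpa using hc)] at hn
        simp at hn
    have hpos : ∀ j (k : Fin b.length), 0 < anc F (k + 1) (j + 1) ↔ j + 1 ≤ gA b k := fun j k => h.gm_pos (j + 1) k
    have hanti : ∀ j (k : Fin b.length), anc F (k + 1) (j + 1 + 1) ≤ anc F (k + 1) (j + 1) := fun j k => h.gm_anti (j + 1) k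
    have hbox : ∀ i j, SBox b i j → ∃ l, ∃ k : Fin b.length, i = k + 1 ∧ j = l + 1 ∧ l + 1 ≤ gA b k := by
      intro i j hb
      rw [SBox_iff] at hb
      obtain ⟨hj, k, hk, hk'⟩ := hb
      exact ⟨j - 1, k, hk, by omega, by omega⟩
    refine ⟨⟨?_, ?_, ?_, ?_, ?_, ?_, ?_⟩, ?_⟩
    · intro i j
      constructor
      · intro hn
        obtain ⟨l, k, rfl, rfl⟩ := hsupp _ _ hn
        rw [SBox_succ]
        exact ⟨by omega, (h.ne (l + 1) k).1 hn⟩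
      · intro hb
        obtain ⟨l, k, rfl, rfl, hj⟩ := hbox _ _ hb
        exact (h.ne (l + 1) k).2 hj
    · intro i j v hv
      obtain ⟨l, k, rfl, rfl⟩ := hsupp _ _ ⟨v, hv⟩
      exact h.pos (l + 1) k v hv
    · intro j i i' hii v hv hv'
      obtain ⟨l, k, rfl, rfl⟩ := hsupp _ _ ⟨v, hv⟩
      obtain ⟨l', k', rfl, _⟩ := hsupp _ _ ⟨v, hv'⟩
      exact h.disj (l + 1) k k' (by rintro rfl; exact hii rfl) v hv hv'
    · intro i j b1 b2
      obtain ⟨l, k, rfl, rfl, hk⟩ := hbox _ _ b1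
      rw [le_infv ((h.ne (l + 1) k).2 hk)]
      exact fun v hv => h.row (l + 1) k v hv
    · intro i i' j hii b1 b2 b3 hl
      obtain ⟨l, k, rfl, rfl, hk⟩ := hbox _ _ b1
      obtain ⟨l', k', rfl, e, hk'⟩ := hbox _ _ b3
      rw [shapeLen_succ, shapeLen_succ] at hl
      have p := (h.pc (l + 1) k k' (by rw [Fin.lt_def]; omega)).1 hl
      simp only [hgm] at p
      have q : anc F (k + 1) (l + 1 + 1) ≠ anc F (k' + 1) (l + 1 + 1) := fun he => by
        have := (h.valid (l + 1 + 1)).2 k k' he ((h.gm_pos _ _).2 (by omega))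
        subst this; omega
      have := hanti l k
      unfold InvTriple; omega
    · intro i i' j hii b1 b2 b3 hl
      obtain ⟨l, k', rfl, rfl, hk'⟩ := hbox _ _ b1
      obtain ⟨l', k, rfl, e, hk⟩ := hbox _ _ b3
      rw [shapeLen_succ, shapeLen_succ] at hl
      have p := (h.pc (l + 1) k k' (by rw [Fin.lt_def]; omega)).2 hl
      simp only [hgm] at p
      have := hanti l k'
      have := (hpos l k).2 (by omega)
      unfold InvTriple; omega
    · intro i j v b1 hv hvn i' b2 hlt hvl hR
      obtain ⟨l, k, rfl, rfl, hk⟩ := hbox _ _ b1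
      obtain ⟨l', k', rfl, e, hk'⟩ := hbox _ _ b2
      refine h.free (l + 1) k v (by omega) hv hvn k' hlt hvl ?_
      rw [hgm]
      rcases hR.2 with h' | h'
      · rw [SBox_succ] at h'
        have := hpos (l + 1) k'
        omega
      · exact h'
    · intro i hb
      obtain ⟨l, k, rfl, e, hk⟩ := hbox _ _ hb
      have hl : l = 0 := by omega
      subst hl
      have main : ∀ m, ∀ k : Fin b.length, k.val = m → 1 ≤ gA b k → anc F (k + 1) 1 = k + 1 := by
        intro m
        induction m using Nat.strong_induction_on with
        | _ m ih =>
          intro k hkm hk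
          have u1 : anc F (k + 1) 1 ≤ k + 1 := by have := h.gm_anti 0 k; rwa [hgm0] at this
          have u2 := (hpos 0 k).2 hk
          by_contra hne
          have hr : anc F (k + 1) (0 + 1) - 1 < k := by simp only [Nat.zero_add] at *; omega
          let r : Fin b.length := ⟨anc F (k + 1) (0 + 1) - 1, by omega⟩
          have hrv : r.val + 1 = anc F (k + 1) (0 + 1) := by simp only [r]; omega
          have p := h.pc 0 r k (by rw [Fin.lt_def]; exact hr)
          simp only [hgm, hgm0] at p
          unfold PC at p
          by_cases hl : gA b r < gA b k
          · have := p.2 hl; omega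
          · have e1 := ih r.val (by simp only [r]; omega) r rfl (by omega)
            have := (h.valid 1).2 r k (by
              show anc F (r + 1) 1 = anc F (k + 1) (0 + 1)
              omega) (by show 0 < anc F (r + 1) 1; omega)
            have : r.val = k.val := by rw [this]
            simp only [r] at this
            omega
      exact main _ k rfl hk
end bij

set_option linter.unusedVariables false
set_option linter.unusedSimpArgs false
section final

theorem toF_succ (b : List ℕ) (G : ℕ → Fin b.length → Finset ℕ) (k : Fin b.length) (j : ℕ) :
    toF b G (k + 1) j = G j k := by
  unfold toF
  rw [dif_pos ⟨by omega, by omega⟩]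
  congr 1

theorem toF_supp (b : List ℕ) (G : ℕ → Fin b.length → Finset ℕ) : SuppF b (toF b G) := by
  intro i j h
  unfold toF
  rw [dif_neg]
  rintro ⟨h1, h2⟩
  exact h ⟨⟨i - 1, by omega⟩, by simp only; omega⟩

theorem lascoux_eq (a : List ℕ) : lascouxPoly a =
    ∑ᶠ G ∈ {G | GFill (gA a.reverse) (fun i => a.reverse.length - i) G}, Wt a.reverse.sum (dat G) := by
  unfold lascouxPoly
  apply finsum_mem_eq_of_bijOn (frF a.reverse)
  · refine ⟨fun F hF => ((LSSF_iff a F).1 hF).1, ?_, ?_⟩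
    · intro F hF F' hF' he
      have s := ((LSSF_iff a F).1 hF).2
      have s' := ((LSSF_iff a F').1 hF').2
      ext1 i; ext1 j
      by_cases h : ∃ k : Fin a.reverse.length, i = k.val + 1
      · obtain ⟨k, rfl⟩ := h
        exact congrFun (congrFun he j) k
      · rw [s i j h, s' i j h]
    · intro G hG
      have e : frF a.reverse (toF a.reverse G) = G := by
        ext1 j; ext1 k; exact toF_succ _ _ _ _
      exact ⟨toF a.reverse G, (LSSF_iff a _).2 ⟨by rw [e]; exact hG, toF_supp _ _⟩, e⟩
  · intro F hF
    rw [← wt_toF ((LSSF_iff a F).1 hF).1 (F := F) (fun i j => rfl), List.sum_reverse]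

theorem atom_eq (b : List ℕ) : atomPoly b =
    ∑ᶠ G ∈ {G | GFill (gA b) (fun i => i.val + 1) G}, Wt b.sum (dat G) := by
  unfold atomPoly
  apply finsum_mem_eq_of_bijOn (frL b)
  · refine ⟨fun F hF => ((LASSF_iff b F).1 hF).1, ?_, ?_⟩
    · intro F hF F' hF' he
      obtain ⟨_, s, z⟩ := (LASSF_iff b F).1 hF
      obtain ⟨_, s', z'⟩ := (LASSF_iff b F').1 hF'
      ext1 i; ext1 j
      cases j with
      | zero => rw [z, z']
      | succ j =>
        by_cases h : ∃ k : Fin b.length, i = k.val + 1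
        · obtain ⟨k, rfl⟩ := h
          exact congrFun (congrFun he (j + 1)) k
        · rw [s i _ h, s' i _ h]
    · intro G hG
      let G' : ℕ → Fin b.length → Finset ℕ := fun j k => if j = 0 then ∅ else G j k
      have e : frL b (toF b G') = G := by
        ext1 j; ext1 k
        unfold frL
        rw [toF_succ]
        simp only [G']
        split_ifs with h
        · subst h; exact (hG.base k).symm
        · rfl
      refine ⟨toF b G', (LASSF_iff b _).2 ⟨by rw [e]; exact hG, toF_supp _ _, fun i => ?_⟩, e⟩
      unfold toF
      split_ifs <;> simp [G']
  · intro F hF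
    rw [← wt_toF ((LASSF_iff b F).1 hF).1 (F := F) (fun i j => rfl)]

theorem zipv_getD (Q : List ℕ) : ∀ q i, i < Q.length → (zipv q Q).getD i (0, 0) = (q + i, Q.getD i 0) := by
  induction Q with
  | nil => intro q i h; simp at h
  | cons c Q ih =>
    intro q i h
    cases i with
    | zero => simp [zipv]
    | succ i =>
      have := ih (q + 1) i (by simpa using h)
      simp only [zipv, List.getD_cons_succ, this]
      congr 1; omega

theorem zrr_getD (r : List ℕ) : ∀ i, i < r.length → (zrr r).getD i (0, 0) = (r.length - i, r.getD i 0) := by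
  induction r with
  | nil => intro i h; simp at h
  | cons c Q ih =>
    intro i h
    cases i with
    | zero => simp [zrr]
    | succ i =>
      have := ih i (by simpa using h)
      simp only [zrr, List.getD_cons_succ, this]
      congr 1; simp

theorem atom_eq' (c : List ℕ) (n : ℕ) (hn : c.length = n) (M : ℕ) (hM : c.sum = M) : atomPoly c =
    ∑ᶠ G ∈ {G | GFill (gL n (zipv 1 c)) (sL n (zipv 1 c)) G}, Wt M (dat G) := by
  subst hn hM
  rw [atom_eq]
  have e1 : gA c = gL c.length (zipv 1 c) := by
    ext i; simp only [gA, gL, zipv_getD c 1 i i.2]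
  have e2 : (fun i : Fin c.length => i.val + 1) = sL c.length (zipv 1 c) := by
    ext i; simp only [sL, zipv_getD c 1 i i.2]; omega
  rw [e1, e2]

theorem lascoux_eq' (a : List ℕ) : lascouxPoly a =
    ∑ᶠ G ∈ {G | GFill (gL a.reverse.length (zrr a.reverse)) (sL a.reverse.length (zrr a.reverse)) G},
      Wt a.reverse.sum (dat G) := by
  rw [lascoux_eq]
  have e1 : gA a.reverse = gL a.reverse.length (zrr a.reverse) := by
    ext i; simp only [gA, gL, zrr_getD a.reverse i i.2]
  have e2 : (fun i : Fin a.reverse.length => a.reverse.length - i.val) = sL a.reverse.length (zrr a.reverse) := by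
    ext i; simp only [sL, zrr_getD a.reverse i i.2]
  rw [e1, e2]

theorem lascoux_atoms (a : List ℕ) : lascouxPoly a = ∑ᶠ c ∈ lswapSet a, atomPoly c := by
  classical
  have hset : lswapSet a = ((LSr a.reverse).toFinset : Set (List ℕ)) := by
    ext d
    rw [Finset.mem_coe, List.mem_toFinset, mem_LSr, List.reverse_reverse]
  rw [hset, finsum_mem_coe_finset, lascoux_eq']
  have hp : ∀ c ∈ (LSr a.reverse).toFinset, c.Perm a.reverse := fun c hc =>
    LSr_perm a.reverse c (List.mem_toFinset.1 hc)
  rw [Finset.sum_congr rfl (fun c hc => atom_eq' c a.reverse.length (hp c hc).length_eq a.reverse.sum (hp c hc).sum_eq)]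
  apply fill_main (M := a.reverse.sum)
  · intro c hc i
    unfold gL
    rw [zipv_getD c 1 i (by rw [(hp c hc).length_eq]; exact i.2), ← (hp c hc).sum_eq]
    exact getD_le_sum c i
  · intro i
    unfold gL
    rw [zrr_getD _ i i.2]
    exact getD_le_sum _ i
  · intro A m
    have := zrr_sum (NN_rel (n := a.reverse.length) A m 0) a.reverse [] (by simp) (by simp)
    simp only [List.nil_append, ev] at this
    rw [this, List.sum_toFinset _ (LSr_nodup _)]

end final

theorem stmt10 (a : List ℕ) : lascouxPoly a = ∑ᶠ b ∈ QlswapSet a, quasiLascoux b := by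
  rw [lascoux_atoms]
  unfold quasiLascoux
  exact (quasi_sum a _).symm
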